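/- arXiv:1304.3948 — 2 statements merged into one kernel-verified Lean document; each statement's English description precedes it below -/
import Mathlib

section
/- Let d ≥ 1 and let F be a nonempty face (convex extreme subset) of the Birkhoff polytope B_{2d} with Module.finrank ℝ ↥(vectorSpan ℝ F) = d. Suppose that for every m < 2d, no face of B_m is combinatorially isomorphic to F (i.e. F has Birkhoff dimension 2d). Then F is combinatorially isomorphic to the d-cube: there is an order isomorphism between the face poset of F and the face poset of Set.Icc (0 : Fin d → ℝ) 1. -/
/-- The permutation matrix of `σ`: entry 1 at `(i, σ i)` and 0 elsewhere. -/
def permMat {n : ℕ} (σ : Equiv.Perm (Fin n)) : Matrix (Fin n) (Fin n) ℝ :=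
  fun i j => if σ i = j then 1 else 0

/-- `σ` is a (perfect) matching of the bipartite graph of `R`. -/
def IsMatching {n : ℕ} (R : Fin n → Fin n → Prop) (σ : Equiv.Perm (Fin n)) : Prop :=
  ∀ i, R i (σ i)

/-- `R` is elementary (a face graph): every edge lies in some matching. -/
def IsElementary {n : ℕ} (R : Fin n → Fin n → Prop) : Prop :=
  ∀ i j, R i j → ∃ σ : Equiv.Perm (Fin n), IsMatching R σ ∧ σ i = j

/-- The face of the Birkhoff polytope corresponding to `R`. -/
def face {n : ℕ} (R : Fin n → Fin n → Prop) : Set (Matrix (Fin n) (Fin n) ℝ) :=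
  convexHull ℝ {M | ∃ σ : Equiv.Perm (Fin n), IsMatching R σ ∧ M = permMat σ}

/-- The bipartite simple graph `G_R` on `Fin n ⊕ Fin n`, where `Sum.inl i` and
`Sum.inr j` are adjacent iff `R i j`. -/
def graphOf {n : ℕ} (R : Fin n → Fin n → Prop) : SimpleGraph (Fin n ⊕ Fin n) :=
  SimpleGraph.fromRel (fun a b => ∃ i j, a = Sum.inl i ∧ b = Sum.inr j ∧ R i j)

/-- The degree of the upper node `i`. -/
def upDeg {n : ℕ} (R : Fin n → Fin n → Prop) [∀ i j, Decidable (R i j)] (i : Fin n) : ℕ :=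
  Fintype.card {j // R i j}

/-- The degree of the lower node `j`. -/
def loDeg {n : ℕ} (R : Fin n → Fin n → Prop) [∀ i j, Decidable (R i j)] (j : Fin n) : ℕ :=
  Fintype.card {i // R i j}

/-- The number of edges of the bipartite graph of `R`. -/
def edgeCount {n : ℕ} (R : Fin n → Fin n → Prop) [∀ i j, Decidable (R i j)] : ℕ :=
  Fintype.card {p : Fin n × Fin n // R p.1 p.2}

/-- An upper node `v` of degree 2 with neighbors `w₁ ≠ w₂` is reducible if no `u ≠ v`
is adjacent to both `w₁` and `w₂`. -/
def UpperReducible {n : ℕ} (R : Fin n → Fin n → Prop) (v : Fin n) : Prop :=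
  ∃ w₁ w₂ : Fin n, w₁ ≠ w₂ ∧ R v w₁ ∧ R v w₂ ∧ (∀ j, R v j → j = w₁ ∨ j = w₂) ∧
    ¬ ∃ u, u ≠ v ∧ R u w₁ ∧ R u w₂

/-- Reducibility of lower nodes, defined symmetrically. -/
def LowerReducible {n : ℕ} (R : Fin n → Fin n → Prop) (v : Fin n) : Prop :=
  UpperReducible (fun i j => R j i) v

/-- `R` is irreducible if none of its nodes is reducible. -/
def IrreducibleRel {n : ℕ} (R : Fin n → Fin n → Prop) : Prop :=
  (∀ v, ¬ UpperReducible R v) ∧ (∀ v, ¬ LowerReducible R v)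

/-- The face poset of a set `P`: the collection of its faces (convex extreme subsets),
ordered by inclusion. -/
def facesOf {E : Type*} [AddCommGroup E] [Module ℝ E] (P : Set E) : Set (Set E) :=
  {F | Convex ℝ F ∧ IsExtreme ℝ P F}

/-- A linear map that is injective on a convex set `P` identifies the face posets of `P` and of
its image. -/
theorem nonempty_facesOf_orderIso_image {E E' : Type*} [AddCommGroup E] [Module ℝ E]
    [AddCommGroup E'] [Module ℝ E'] (f : E →ₗ[ℝ] E') {P : Set E} (hP : Convex ℝ P)
    (hf : Set.InjOn f P) : Nonempty (↥(facesOf P) ≃o ↥(facesOf (f '' P))) := by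
  have image_mem : ∀ A ∈ facesOf P, f '' A ∈ facesOf (f '' P) := by
    rintro A ⟨hA, hPA⟩
    refine ⟨hA.linear_image f, Set.image_mono hPA.1, ?_⟩
    rintro _ ⟨a, ha, rfl⟩ _ ⟨b, hb, rfl⟩ _ ⟨z, hz, rfl⟩ ⟨s, t, hs, ht, hst, h⟩
    refine ⟨a, ?_, rfl⟩
    refine hPA.2 ha hb hz ⟨s, t, hs, ht, hst, ?_⟩
    refine hf (hP ha hb hs.le ht.le hst) (hPA.1 hz) ?_
    simpa using h
  have preimage_mem : ∀ B ∈ facesOf (f '' P), P ∩ f ⁻¹' B ∈ facesOf P := by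
    rintro B ⟨hB, hPB⟩
    refine ⟨hP.inter (hB.linear_preimage f), Set.inter_subset_left, ?_⟩
    rintro a ha b hb z ⟨hz, hzB⟩ ⟨s, t, hs, ht, hst, h⟩
    refine ⟨ha, ?_⟩
    refine hPB.2 ⟨a, ha, rfl⟩ ⟨b, hb, rfl⟩ hzB ⟨s, t, hs, ht, hst, ?_⟩
    simp [← h]
  have left_inv : ∀ A ⊆ P, P ∩ f ⁻¹' (f '' A) = A := by
    intro A hA
    rw [Set.inter_comm]
    exact hf.preimage_image_inter hA
  have right_inv : ∀ B ⊆ f '' P, f '' (P ∩ f ⁻¹' B) = B := by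
    intro B hB
    rw [Set.image_inter_preimage, Set.inter_eq_right.2 hB]
  refine ⟨{
    toFun := fun A => ⟨f '' A.1, image_mem A.1 A.2⟩
    invFun := fun B => ⟨P ∩ f ⁻¹' B.1, preimage_mem B.1 B.2⟩
    left_inv := fun A => Subtype.ext (left_inv A.1 A.2.2.1)
    right_inv := fun B => Subtype.ext (right_inv B.1 B.2.2.1)
    map_rel_iff' := ?_ }⟩
  rintro ⟨A, hA⟩ ⟨B, hB⟩
  change f '' A ⊆ f '' B ↔ A ⊆ B
  refine ⟨fun h => ?_, fun h => Set.image_mono h⟩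
  rw [← left_inv A hA.2.1, ← left_inv B hB.2.1]
  exact Set.inter_subset_inter_right _ (Set.preimage_mono h)

/-- The doubly stochastic matrices with a prescribed set of allowed nonzero entries form a convex
extreme subset. -/
theorem mem_facesOf_doublyStochastic_of_support {ι : Type*} [Fintype ι] [DecidableEq ι]
    {R : ι → ι → Prop} {F : Set (Matrix ι ι ℝ)}
    (hF : ∀ M, M ∈ F ↔ M ∈ doublyStochastic ℝ ι ∧ ∀ i j, M i j ≠ 0 → R i j) :
    F ∈ facesOf (doublyStochastic ℝ ι : Set (Matrix ι ι ℝ)) := by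
  refine ⟨?_, fun M hM => ((hF M).1 hM).1, ?_⟩
  · intro A hA B hB s t hs ht hst
    rw [hF] at *
    refine ⟨convex_doublyStochastic hA.1 hB.1 hs ht hst, fun i j h => ?_⟩
    by_contra hR
    have h1 := not_not.1 (mt (hA.2 i j) hR)
    have h2 := not_not.1 (mt (hB.2 i j) hR)
    simp [h1, h2] at h
  · rintro A hA B hB M hM ⟨s, t, hs, ht, hst, rfl⟩
    rw [hF] at *
    refine ⟨hA, fun i j h => hM.2 i j ?_⟩
    have h1 : 0 < A i j := lt_of_le_of_ne (hA.1 i j) (Ne.symm h)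
    have h2 : 0 ≤ B i j := hB.1 i j
    simp only [Matrix.add_apply, Matrix.smul_apply, smul_eq_mul]
    positivity

/-- A nonempty face of the Birkhoff polytope has a point that is positive at every entry at which
some point of the face does not vanish. -/
theorem exists_pos_of_mem_facesOf {ι : Type*} [Fintype ι] [DecidableEq ι] {F : Set (Matrix ι ι ℝ)}
    (hne : F.Nonempty) (hF : F ∈ facesOf (doublyStochastic ℝ ι : Set (Matrix ι ι ℝ))) :
    ∃ A ∈ F, ∀ M ∈ F, ∀ i j, M i j ≠ 0 → 0 < A i j := by
  have key : ∀ T : Finset (ι × ι), ∃ A ∈ F, ∀ p ∈ T, ∀ M ∈ F, M p.1 p.2 ≠ 0 → 0 < A p.1 p.2 := by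
    intro T
    induction T using Finset.induction_on with
    | empty =>
      obtain ⟨A, hA⟩ := hne
      exact ⟨A, hA, by simp⟩
    | insert p T _ ih =>
      obtain ⟨A, hA, h⟩ := ih
      by_cases hp : ∃ B ∈ F, B p.1 p.2 ≠ 0
      · obtain ⟨B, hB, hBp⟩ := hp
        refine ⟨(1 / 2 : ℝ) • A + (1 / 2 : ℝ) • B,
          hF.1 hA hB (by norm_num) (by norm_num) (by norm_num), fun q hq M hM hMq => ?_⟩
        have hAq : 0 ≤ A q.1 q.2 := (hF.2.1 hA).1 _ _
        have hBq : 0 ≤ B q.1 q.2 := (hF.2.1 hB).1 _ _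
        simp only [Matrix.add_apply, Matrix.smul_apply, smul_eq_mul]
        rcases Finset.mem_insert.1 hq with rfl | hq
        · have := lt_of_le_of_ne hBq (Ne.symm hBp)
          positivity
        · have := h q hq M hM hMq
          positivity
      · push Not at hp
        refine ⟨A, hA, fun q hq M hM hMq => ?_⟩
        rcases Finset.mem_insert.1 hq with rfl | hq
        · exact absurd (hp M hM) hMq
        · exact h q hq M hM hMq
  obtain ⟨A, hA, h⟩ := key Finset.univ
  exact ⟨A, hA, fun M hM i j => h (i, j) (Finset.mem_univ _) M hM⟩

/-- A direction with vanishing row and column sums that is supported where `A` is positive keeps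
`A` doubly stochastic for a short time. -/
theorem exists_add_smul_mem_doublyStochastic {ι : Type*} [Fintype ι] [DecidableEq ι]
    {A X : Matrix ι ι ℝ} (hA : A ∈ doublyStochastic ℝ ι) (hX : ∀ i j, X i j ≠ 0 → 0 < A i j)
    (hrow : ∀ i, ∑ j, X i j = 0) (hcol : ∀ j, ∑ i, X i j = 0) :
    ∃ ε : ℝ, 0 < ε ∧ A + ε • X ∈ doublyStochastic ℝ ι := by
  have key : ∀ T : Finset (ι × ι), ∃ ε : ℝ, 0 < ε ∧
      ∀ p ∈ T, 0 ≤ A p.1 p.2 - ε * |X p.1 p.2| := by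
    intro T
    induction T using Finset.induction_on with
    | empty => exact ⟨1, one_pos, by simp⟩
    | insert p T _ ih =>
      obtain ⟨ε, hε, h⟩ := ih
      by_cases hp : X p.1 p.2 = 0
      · refine ⟨ε, hε, fun q hq => ?_⟩
        rcases Finset.mem_insert.1 hq with rfl | hq
        · simpa [hp] using hA.1 q.1 q.2
        · exact h q hq
      · have hXp := abs_pos.2 hp
        have hAp := hX _ _ hp
        refine ⟨min ε (A p.1 p.2 / |X p.1 p.2|), by positivity, fun q hq => ?_⟩
        rw [sub_nonneg]
        rcases Finset.mem_insert.1 hq with rfl | hq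
        · calc _ ≤ A q.1 q.2 / |X q.1 q.2| * |X q.1 q.2| := by gcongr; exact min_le_right _ _
            _ = _ := div_mul_cancel₀ _ hXp.ne'
        · calc _ ≤ ε * |X q.1 q.2| := by gcongr; exact min_le_left _ _
            _ ≤ _ := sub_nonneg.1 (h q hq)
  obtain ⟨ε, hε, h⟩ := key Finset.univ
  refine ⟨ε, hε, ?_⟩
  rw [mem_doublyStochastic_iff_sum] at hA ⊢
  simp only [Matrix.add_apply, Matrix.smul_apply, smul_eq_mul, Finset.sum_add_distrib,
    ← Finset.mul_sum, hrow, hcol, hA.2.1, hA.2.2]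
  refine ⟨fun i j => ?_, by simp, by simp⟩
  have h1 := h (i, j) (Finset.mem_univ _)
  have h2 := mul_le_mul_of_nonneg_left (neg_abs_le (X i j)) hε.le
  simp only at h1
  linarith

/-- A face of the Birkhoff polytope is determined by the support of a point of full support. -/
theorem mem_face_iff_support {ι : Type*} [Fintype ι] [DecidableEq ι] {F : Set (Matrix ι ι ℝ)}
    (hF : F ∈ facesOf (doublyStochastic ℝ ι : Set (Matrix ι ι ℝ))) {A : Matrix ι ι ℝ}
    (hA : A ∈ F) (hpos : ∀ M ∈ F, ∀ i j, M i j ≠ 0 → 0 < A i j) (M : Matrix ι ι ℝ) :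
    M ∈ F ↔ M ∈ doublyStochastic ℝ ι ∧ ∀ i j, M i j ≠ 0 → A i j ≠ 0 := by
  refine ⟨fun hM => ⟨hF.2.1 hM, fun i j h => (hpos M hM i j h).ne'⟩, fun ⟨hM, hMA⟩ => ?_⟩
  have hA' := hF.2.1 hA
  have hA'' := hA'
  have hM' := hM
  rw [SetLike.mem_coe, mem_doublyStochastic_iff_sum] at hA''
  rw [mem_doublyStochastic_iff_sum] at hM'
  obtain ⟨ε, hε, h⟩ := exists_add_smul_mem_doublyStochastic (X := A - M) hA'
    (fun i j h => by
      by_cases hAij : A i j = 0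
      · have := not_not.1 (mt (hMA i j) (not_not.2 hAij))
        simp [hAij, this] at h
      · exact hpos A hA i j hAij)
    (by simp [hA''.2.1, hM'.2.1]) (by simp [hA''.2.2, hM'.2.2])
  refine hF.2.2 hM h hA ⟨ε / (1 + ε), 1 / (1 + ε), by positivity, by positivity, by field_simp; ring, ?_⟩
  ext i j
  simp only [Matrix.add_apply, Matrix.smul_apply, Matrix.sub_apply, smul_eq_mul]
  field_simp
  ring

/-- Row mass counting: if the rows in `S` of a doubly stochastic matrix are supported on the
columns in `T`, then the remaining mass of the columns in `T` is `|T| - |S|`. -/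
theorem card_add_sum_compl_eq_card {ι : Type*} [Fintype ι] [DecidableEq ι] {A : Matrix ι ι ℝ}
    (hA : A ∈ doublyStochastic ℝ ι) (S T : Finset ι) (h : ∀ i ∈ S, ∀ j, A i j ≠ 0 → j ∈ T) :
    (S.card : ℝ) + ∑ j ∈ T, ∑ i ∈ Sᶜ, A i j = T.card := by
  rw [mem_doublyStochastic_iff_sum] at hA
  have h1 : (S.card : ℝ) = ∑ j ∈ T, ∑ i ∈ S, A i j := by
    rw [Finset.sum_comm, Finset.cast_card]
    refine Finset.sum_congr rfl fun i hi => ?_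
    rw [← hA.2.1 i]
    refine (Finset.sum_subset (Finset.subset_univ T) fun j _ hj => ?_).symm
    exact not_not.1 (mt (h i hi j) hj)
  rw [h1, ← Finset.sum_add_distrib, Finset.cast_card]
  exact Finset.sum_congr rfl fun j _ => by rw [Finset.sum_add_sum_compl, hA.2.2]

/-- Tightness: a set of rows that sees no more columns than it has rows uses up these columns. -/
theorem eq_zero_of_card_le {ι : Type*} [Fintype ι] [DecidableEq ι] {A : Matrix ι ι ℝ}
    (hA : A ∈ doublyStochastic ℝ ι) (S T : Finset ι) (h : ∀ i ∈ S, ∀ j, A i j ≠ 0 → j ∈ T)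
    (hcard : T.card ≤ S.card) {i j : ι} (hi : i ∉ S) (hj : j ∈ T) : A i j = 0 := by
  have h1 := card_add_sum_compl_eq_card hA S T h
  have h2 : (T.card : ℝ) ≤ S.card := by exact_mod_cast hcard
  have hnn : ∀ j ∈ T, 0 ≤ ∑ i ∈ Sᶜ, A i j := fun j _ => Finset.sum_nonneg fun i _ => hA.1 i j
  have h3 : ∑ j ∈ T, ∑ i ∈ Sᶜ, A i j = 0 := le_antisymm (by linarith) (Finset.sum_nonneg hnn)
  have h4 := (Finset.sum_eq_zero_iff_of_nonneg hnn).1 h3 j hj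
  exact (Finset.sum_eq_zero_iff_of_nonneg fun i _ => hA.1 i j).1 h4 i (Finset.mem_compl.2 hi)

/-- Hall's condition for the support of a doubly stochastic matrix. -/
theorem card_le_of_support {ι : Type*} [Fintype ι] [DecidableEq ι] {A : Matrix ι ι ℝ}
    (hA : A ∈ doublyStochastic ℝ ι) (S T : Finset ι) (h : ∀ i ∈ S, ∀ j, A i j ≠ 0 → j ∈ T) :
    S.card ≤ T.card := by
  have h1 := card_add_sum_compl_eq_card hA S T h
  have h2 : 0 ≤ ∑ j ∈ T, ∑ i ∈ Sᶜ, A i j :=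
    Finset.sum_nonneg fun j _ => Finset.sum_nonneg fun i _ => hA.1 i j
  have h3 : (S.card : ℝ) ≤ T.card := by linarith
  exact_mod_cast h3

/-- The dimension of a face is at least `e + k - 2n`, where `e` is the number of edges, `k` the
number of connected components and `n` the number of rows of its bipartite graph. -/
theorem card_support_add_card_le_finrank_add {ι C : Type*} [Fintype ι] [DecidableEq ι] [Fintype C]
    [DecidableEq C] {F : Set (Matrix ι ι ℝ)} {A : Matrix ι ι ℝ} (hA : A ∈ F)
    (hAd : A ∈ doublyStochastic ℝ ι)
    (hF : ∀ M ∈ doublyStochastic ℝ ι, (∀ i j, M i j ≠ 0 → A i j ≠ 0) → M ∈ F)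
    (κ μ : ι → C) (hκ : Function.Surjective κ) (hκμ : ∀ i j, A i j ≠ 0 → κ i = μ j) :
    Nat.card {p : ι × ι // A p.1 p.2 ≠ 0} + Fintype.card C ≤
      Module.finrank ℝ ↥(vectorSpan ℝ F) + 2 * Fintype.card ι := by
  classical
  let ext : ({p : ι × ι // A p.1 p.2 ≠ 0} → ℝ) →ₗ[ℝ] Matrix ι ι ℝ :=
    { toFun := fun x => Matrix.of fun i j => if h : A i j ≠ 0 then x ⟨(i, j), h⟩ else 0
      map_add' := fun x y => by
        ext i j
        by_cases h : A i j = 0 <;> simp [h]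
      map_smul' := fun c x => by
        ext i j
        by_cases h : A i j = 0 <;> simp [h] }
  have ext_supp : ∀ x i j, ext x i j ≠ 0 → A i j ≠ 0 := fun x i j h => by
    by_contra h0
    exact h (dif_neg (not_not.2 h0))
  have ext_inj : Function.Injective ext := fun x y h => by
    ext ⟨⟨i, j⟩, hp⟩
    have := congrFun (congrFun h i) j
    simpa [ext, hp] using this
  let sums : Matrix ι ι ℝ →ₗ[ℝ] (ι → ℝ) × (ι → ℝ) :=
    { toFun := fun X => (fun i => ∑ j, X i j, fun j => ∑ i, X i j)
      map_add' := fun X Y => by ext <;> simp [Finset.sum_add_distrib]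
      map_smul' := fun c X => by ext <;> simp [Finset.mul_sum] }
  let defect : (ι → ℝ) × (ι → ℝ) →ₗ[ℝ] (C → ℝ) :=
    { toFun := fun p c => ∑ i with κ i = c, p.1 i - ∑ j with μ j = c, p.2 j
      map_add' := fun p q => by
        ext c
        simp [Finset.sum_add_distrib]
        ring
      map_smul' := fun a p => by
        ext c
        simp [Finset.mul_sum, mul_sub] }
  have defect_surj : Function.Surjective defect := fun y => by
    choose r hr using hκ
    refine ⟨(fun i => if i = r (κ i) then y (κ i) else 0, 0), ?_⟩
    ext c
    change ∑ i with κ i = c, (if i = r (κ i) then y (κ i) else 0) - ∑ j with μ j = c, (0 : ℝ) = y c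
    rw [Finset.sum_const_zero, sub_zero, Finset.sum_eq_single (r c)]
    · simp [hr]
    · intro i hi hne
      rw [Finset.mem_filter] at hi
      rw [if_neg]
      rwa [hi.2]
    · intro h
      exact absurd (by simp [hr]) h
  let T := sums ∘ₗ ext
  have range_le : LinearMap.range T ≤ LinearMap.ker defect := by
    rintro _ ⟨x, rfl⟩
    rw [LinearMap.mem_ker]
    ext c
    change ∑ i with κ i = c, ∑ j, ext x i j - ∑ j with μ j = c, ∑ i, ext x i j = 0
    rw [sub_eq_zero, Finset.sum_filter, Finset.sum_filter, Finset.sum_congr rfl fun i _ =>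
      show (if κ i = c then ∑ j, ext x i j else 0) = ∑ j, if κ i = c then ext x i j else 0 by
        split_ifs <;> simp, Finset.sum_comm]
    refine Finset.sum_congr rfl fun j _ => ?_
    rw [show (if μ j = c then ∑ i, ext x i j else 0) = ∑ i, if μ j = c then ext x i j else 0 by
      split_ifs <;> simp]
    refine Finset.sum_congr rfl fun i _ => ?_
    by_cases h : ext x i j = 0
    · simp [h]
    · rw [hκμ i j (ext_supp x i j h)]
  have ker_le : (LinearMap.ker T).map ext ≤ vectorSpan ℝ F := by
    rintro _ ⟨x, hx, rfl⟩
    have hx' : sums (ext x) = 0 := hx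
    have hrow : ∀ i, ∑ j, ext x i j = 0 := fun i => congrFun (congrArg Prod.fst hx') i
    have hcol : ∀ j, ∑ i, ext x i j = 0 := fun j => congrFun (congrArg Prod.snd hx') j
    obtain ⟨ε, hε, h⟩ := exists_add_smul_mem_doublyStochastic hAd
      (fun i j h => lt_of_le_of_ne (hAd.1 i j) (ext_supp x i j h).symm) hrow hcol
    have hmem : A + ε • ext x ∈ F := hF _ h fun i j hne h0 => by
      have := not_not.1 (mt (ext_supp x i j) (not_not.2 h0))
      simp [h0, this] at hne
    have := vsub_mem_vectorSpan ℝ hmem hA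
    rw [vsub_eq_sub, add_sub_cancel_left] at this
    simpa [smul_smul, hε.ne'] using (vectorSpan ℝ F).smul_mem ε⁻¹ this
  have h1 := LinearMap.finrank_range_add_finrank_ker T
  have h2 := LinearMap.finrank_range_add_finrank_ker defect
  have h3 := Submodule.finrank_mono range_le
  have h4 := Submodule.finrank_mono ker_le
  rw [← (Submodule.equivMapOfInjective ext ext_inj _).finrank_eq] at h4
  rw [LinearMap.range_eq_top.2 defect_surj, finrank_top] at h2
  simp only [Module.finrank_prod, Module.finrank_fintype_fun_eq_card] at h1 h2
  rw [Nat.card_eq_fintype_card]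
  omega

/-- The extremal case of the bound `n ≤ 2d` for a bipartite graph with `n` rows that satisfies
Hall's condition, whose tight row sets are unions of components, and in which the neighbourhood of
every row of degree two is contained in that of another row: all components are copies of
`K₂,₂`. -/
theorem components_of_card_eq {ι C : Type*} [Fintype ι] [DecidableEq ι] [Fintype C] [DecidableEq C]
    (N : ι → Finset ι) (κ μ : ι → C) {d : ℕ}
    (hall : ∀ S T : Finset ι, (∀ i ∈ S, N i ⊆ T) → S.card ≤ T.card)
    (tight : ∀ S T : Finset ι, (∀ i ∈ S, N i ⊆ T) → T.card ≤ S.card →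
      ∀ i ∈ S, ∀ i', κ i = κ i' → i' ∈ S)
    (two_le : ∀ i, 2 ≤ (N i).card)
    (partner : ∀ v, (N v).card = 2 → ∃ u, u ≠ v ∧ N v ⊆ N u)
    (hκ : Function.Surjective κ) (hκμ : ∀ i, ∀ j ∈ N i, κ i = μ j)
    (hcol : ∀ j, ∃ i, j ∈ N i)
    (hcard : Fintype.card ι = 2 * d)
    (hdim : ∑ i, (N i).card + Fintype.card C ≤ d + 2 * Fintype.card ι) :
    Fintype.card C = d ∧ (∀ i j, κ i = μ j → j ∈ N i) ∧
      (∀ c, (Finset.univ.filter fun i => κ i = c).card = 2) ∧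
      (∀ c, (Finset.univ.filter fun j => μ j = c).card = 2) := by
  have pair : ∀ v, (N v).card = 2 → ∀ u, u ≠ v → N v ⊆ N u → (N u).card = 2 →
      ∀ i, κ v = κ i → i = v ∨ i = u := by
    intro v hv u huv hsub hu i hi
    have heq : N v = N u := Finset.eq_of_subset_of_card_le hsub (by omega)
    have := tight {v, u} (N v) (by simp [heq])
      (by rw [Finset.card_pair huv.symm]; omega) v (by simp) i hi
    simpa using this
  have same : ∀ v u, N v ⊆ N u → κ v = κ u := by
    intro v u h
    obtain ⟨j, hj⟩ : (N v).Nonempty := Finset.card_pos.1 (by have := two_le v; omega)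
    rw [hκμ v j hj, hκμ u j (h hj)]
  choose x hx using fun i => Nat.exists_eq_add_of_le (two_le i)
  have bound_lt : ∀ c, (∃ i, κ i = c ∧ (N i).card ≠ 2) →
      (Finset.univ.filter fun i => κ i = c).card <
        2 + 2 * ∑ i with κ i = c, x i := by
    rintro c ⟨w, hwc, hw⟩
    have hp : ∀ v, ∃ u, N v ⊆ N u ∧ (κ v = c → (N u).card ≠ 2) := by
      intro v
      by_cases hv : (N v).card = 2
      · obtain ⟨u, huv, hu⟩ := partner v hv
        refine ⟨u, hu, fun hvc hu2 => ?_⟩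
        rcases pair v hv u huv hu hu2 w (hvc.trans hwc.symm) with rfl | rfl
        · exact hw hv
        · exact hw hu2
      · exact ⟨v, subset_rfl, fun _ => hv⟩
    choose p hpN hp2 using hp
    have hB : ∀ u, (Finset.univ.filter fun v => p v = u).card ≤ (N u).card := fun u =>
      hall _ _ fun v hv => by
        rw [Finset.mem_filter] at hv
        exact hv.2 ▸ hpN v
    have hsum : ∀ u, κ u = c → x u ≤ ∑ i with κ i = c, x i := fun u hu =>
      Finset.single_le_sum (f := x) (fun _ _ => Nat.zero_le _) (by simp [hu])
    by_cases hfull : ∃ v, κ v = c ∧ (N (p v)).card ≤ (Finset.univ.filter fun v' => p v' = p v).card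
    · obtain ⟨v, hvc, hv⟩ := hfull
      have hsub : (Finset.univ.filter fun i => κ i = c) ⊆
          Finset.univ.filter fun v' => p v' = p v := fun i hi => by
        refine tight _ _ (fun v' hv' => ?_) hv v (by simp) i ?_
        · rw [Finset.mem_filter] at hv'
          exact hv'.2 ▸ hpN v'
        · rw [hvc, (Finset.mem_filter.1 hi).2]
      have h1 := Finset.card_le_card hsub
      have h2 := hB (p v)
      have h3 := hsum (p v) ((same v _ (hpN v)).symm.trans hvc)
      have h4 := hp2 v hvc
      have h5 := hx (p v)
      omega
    · push Not at hfull
      have hmaps : ((Finset.univ.filter fun i => κ i = c : Finset ι) : Set ι).MapsTo p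
          (Finset.univ.filter fun i => κ i = c : Finset ι) := fun v hv => by
        simp only [Finset.coe_filter, Finset.mem_univ, true_and, Set.mem_ofPred_eq] at hv ⊢
        rw [← same v _ (hpN v), hv]
      rw [Finset.card_eq_sum_card_fiberwise hmaps]
      refine lt_of_le_of_lt (b := 2 * ∑ i with κ i = c, x i) ?_ (by omega)
      rw [Finset.mul_sum]
      refine Finset.sum_le_sum fun u _ => ?_
      rcases Finset.eq_empty_or_nonempty
        (Finset.filter (fun a => p a = u) (Finset.univ.filter fun i => κ i = c)) with h0 | ⟨v, hv⟩
      · simp [h0]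
      · simp only [Finset.mem_filter, Finset.mem_univ, true_and] at hv
        obtain ⟨hvc, rfl⟩ := hv
        have h1 := hfull v hvc
        have h2 := hp2 v hvc
        have h3 := hx (p v)
        have h4 := Finset.card_le_card (Finset.filter_subset_filter (fun a => p a = p v)
          (Finset.subset_univ (Finset.univ.filter fun i => κ i = c)))
        omega
  have fiber_eq : ∀ v, (N v).card = 2 → ∀ u, u ≠ v → N v ⊆ N u → (N u).card = 2 →
      (Finset.univ.filter fun i => κ i = κ v) = {v, u} := by
    intro v hv u huv hsub hu
    ext i
    simp only [Finset.mem_filter, Finset.mem_univ, true_and, Finset.mem_insert,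
      Finset.mem_singleton]
    refine ⟨fun h => pair v hv u huv hsub hu i h.symm, ?_⟩
    rintro (rfl | rfl)
    · rfl
    · exact (same _ _ hsub).symm
  have fiber_card : ∀ c, (∀ i, κ i = c → (N i).card = 2) →
      (Finset.univ.filter fun i => κ i = c).card = 2 := by
    intro c hc
    obtain ⟨v, rfl⟩ := hκ c
    obtain ⟨u, huv, hu⟩ := partner v (hc v rfl)
    rw [fiber_eq v (hc v rfl) u huv hu (hc u (same v u hu).symm), Finset.card_pair huv.symm]
  have bound_le : ∀ c, (Finset.univ.filter fun i => κ i = c).card ≤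
      2 + 2 * ∑ i with κ i = c, x i := by
    intro c
    by_cases hc : ∃ i, κ i = c ∧ (N i).card ≠ 2
    · exact (bound_lt c hc).le
    · push Not at hc
      rw [fiber_card c hc]
      omega
  have hn : Fintype.card ι = ∑ c, (Finset.univ.filter fun i => κ i = c).card :=
    Finset.card_eq_sum_card_fiberwise fun _ _ => Finset.mem_coe.2 (Finset.mem_univ _)
  have htot : ∑ c, (2 + 2 * ∑ i with κ i = c, x i) = 2 * Fintype.card C + 2 * ∑ i, x i := by
    rw [Finset.sum_add_distrib, ← Finset.mul_sum, Finset.sum_fiberwise]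
    simp [mul_comm]
  have hdeg : ∑ i, (N i).card = 2 * Fintype.card ι + ∑ i, x i := by
    rw [Finset.sum_congr rfl fun i _ => hx i, Finset.sum_add_distrib]
    simp [mul_comm]
  have all_two : ∀ i, (N i).card = 2 := by
    by_contra! h
    obtain ⟨i, hi⟩ := h
    have := Finset.sum_lt_sum (fun c _ => bound_le c)
      ⟨κ i, Finset.mem_univ _, bound_lt (κ i) ⟨i, rfl, hi⟩⟩
    omega
  have hfib : ∀ c, (Finset.univ.filter fun i => κ i = c).card = 2 := fun c =>
    fiber_card c fun i _ => all_two i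
  have hmem : ∀ i j, κ i = μ j → j ∈ N i := by
    intro i j hij
    obtain ⟨i', hi'⟩ := hcol j
    obtain ⟨u, hui, hu⟩ := partner i (all_two i)
    have heq : N i = N u := Finset.eq_of_subset_of_card_le hu (by rw [all_two, all_two])
    rcases pair i (all_two i) u hui hu (all_two u) i' (hij.trans (hκμ i' j hi').symm) with rfl | rfl
    · exact hi'
    · rwa [heq]
  refine ⟨?_, hmem, hfib, fun c => ?_⟩
  · simp only [hfib, Finset.sum_const, Finset.card_univ, smul_eq_mul] at hn
    omega
  · obtain ⟨v, rfl⟩ := hκ c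
    rw [← all_two v]
    congr 1
    ext j
    simp only [Finset.mem_filter, Finset.mem_univ, true_and]
    exact ⟨fun h => hmem v j h.symm, fun h => (hκμ v j h).symm⟩

/-- Contracting a row `v` whose support lies in two columns that have no other common row realises
a face of the Birkhoff polytope of order `m + 1` as a face of the one of order `m`. -/
theorem exists_orderIso_of_reducible {m : ℕ} {F : Set (Matrix (Fin (m + 1)) (Fin (m + 1)) ℝ)}
    {R : Fin (m + 1) → Fin (m + 1) → Prop} {v w₁ w₂ : Fin (m + 1)} (hw : w₁ ≠ w₂)
    (hF : ∀ M, M ∈ F ↔ M ∈ doublyStochastic ℝ (Fin (m + 1)) ∧ ∀ i j, M i j ≠ 0 → R i j)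
    (hv : ∀ j, R v j → j = w₁ ∨ j = w₂) (hv₁ : R v w₁) (hv₂ : R v w₂)
    (hu : ∀ u, u ≠ v → R u w₁ → ¬ R u w₂) :
    ∃ F' ∈ facesOf (doublyStochastic ℝ (Fin m) : Set (Matrix (Fin m) (Fin m) ℝ)),
      Nonempty (↥(facesOf F) ≃o ↥(facesOf F')) := by
  classical
  obtain ⟨c, rfl⟩ := Fin.exists_succAbove_eq hw
  let f : Matrix (Fin (m + 1)) (Fin (m + 1)) ℝ →ₗ[ℝ] Matrix (Fin m) (Fin m) ℝ :=
    { toFun := fun M => Matrix.of fun i j => M (v.succAbove i) (w₂.succAbove j) +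
        if j = c then M (v.succAbove i) w₂ else 0
      map_add' := fun M M' => by
        ext i j
        by_cases h : j = c <;> (simp [h]; try ring)
      map_smul' := fun a M => by
        ext i j
        by_cases h : j = c <;> (simp [h]; try ring) }
  have f_apply : ∀ M i j, f M i j = M (v.succAbove i) (w₂.succAbove j) +
      if j = c then M (v.succAbove i) w₂ else 0 := fun _ _ _ => rfl
  have f_row : ∀ M i, ∑ j, f M i j = ∑ j, M (v.succAbove i) j := fun M i => by
    simp [f_apply, Finset.sum_add_distrib, Fin.sum_univ_succAbove _ w₂, add_comm]
  have f_col : ∀ M ∈ F, ∀ j, ∑ i, f M i j = 1 := fun M hM j => by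
    obtain ⟨hMd, hMR⟩ := (hF M).1 hM
    rw [mem_doublyStochastic_iff_sum] at hMd
    have hr := hMd.2.1 v
    have h1 := hMd.2.2 (w₂.succAbove j)
    have h2 := hMd.2.2 w₂
    rw [Fin.sum_univ_succAbove _ w₂] at hr
    rw [Fin.sum_univ_succAbove _ v] at h1 h2
    have hz : ∀ j, j ≠ c → M v (w₂.succAbove j) = 0 := fun j hj => by
      by_contra h
      rcases hv _ (hMR _ _ h) with h | h
      · exact hj (Fin.succAbove_right_injective h)
      · exact Fin.succAbove_ne _ _ h
    rw [Finset.sum_eq_single c (fun j _ hj => hz j hj) (by simp)] at hr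
    by_cases hj : j = c
    · subst hj
      simp only [f_apply, if_true, Finset.sum_add_distrib]
      linarith
    · simp only [f_apply, if_neg hj, add_zero]
      linarith [hz j hj]
  have f_inj : Set.InjOn f F := by
    intro M hM M' hM' h
    obtain ⟨hMd, hMR⟩ := (hF M).1 hM
    obtain ⟨hMd', hMR'⟩ := (hF M').1 hM'
    rw [mem_doublyStochastic_iff_sum] at hMd hMd'
    have hz : ∀ i j, ¬ R i j → M i j = 0 ∧ M' i j = 0 := fun i j hR =>
      ⟨not_not.1 (mt (hMR i j) hR), not_not.1 (mt (hMR' i j) hR)⟩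
    have hrows : ∀ i j, M (v.succAbove i) j = M' (v.succAbove i) j := by
      intro i
      have hij : ∀ j, f M i j = f M' i j := fun j => by rw [h]
      have hc := hij c
      simp only [f_apply, if_true] at hc
      have hor : M (v.succAbove i) (w₂.succAbove c) = M' (v.succAbove i) (w₂.succAbove c) ∧
          M (v.succAbove i) w₂ = M' (v.succAbove i) w₂ := by
        by_cases hR : R (v.succAbove i) (w₂.succAbove c)
        · obtain ⟨h1, h2⟩ := hz _ _ (hu _ (Fin.succAbove_ne _ _) hR)
          rw [h1, h2] at hc ⊢
          exact ⟨by linarith, rfl⟩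
        · obtain ⟨h1, h2⟩ := hz _ _ hR
          rw [h1, h2] at hc ⊢
          exact ⟨rfl, by linarith⟩
      intro j
      rcases Fin.eq_self_or_eq_succAbove w₂ j with rfl | ⟨j, rfl⟩
      · exact hor.2
      · by_cases hj : j = c
        · rw [hj]
          exact hor.1
        · simpa [f_apply, hj] using hij j
    ext i j
    rcases Fin.eq_self_or_eq_succAbove v i with rfl | ⟨i, rfl⟩
    · have h1 := hMd.2.2 j
      have h2 := hMd'.2.2 j
      rw [Fin.sum_univ_succAbove _ i] at h1 h2
      rw [Finset.sum_congr rfl fun k _ => hrows k j] at h1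
      linarith
    · exact hrows i j
  have hFc : Convex ℝ F := (mem_facesOf_doublyStochastic_of_support hF).1
  refine ⟨f '' F, mem_facesOf_doublyStochastic_of_support (R := fun i j =>
    R (v.succAbove i) (w₂.succAbove j) ∨ j = c ∧ R (v.succAbove i) w₂) fun X => ⟨?_, ?_⟩,
    nonempty_facesOf_orderIso_image f hFc f_inj⟩
  · rintro ⟨M, hM, rfl⟩
    obtain ⟨hMd, hMR⟩ := (hF M).1 hM
    refine ⟨?_, fun i j h => ?_⟩
    · rw [mem_doublyStochastic_iff_sum] at hMd ⊢
      refine ⟨fun i j => ?_, fun i => (f_row M i).trans (hMd.2.1 _), f_col M hM⟩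
      rw [f_apply]
      have h1 := hMd.1 (v.succAbove i) (w₂.succAbove j)
      have h2 := hMd.1 (v.succAbove i) w₂
      split_ifs <;> linarith
    · by_contra! hR
      have h1 := not_not.1 (mt (hMR _ _) hR.1)
      rw [f_apply, h1, zero_add] at h
      split_ifs at h with hj
      · exact hR.2 hj (hMR _ _ h)
      · exact h rfl
  · rintro ⟨hX, hXR⟩
    rw [mem_doublyStochastic_iff_sum] at hX
    let M : Matrix (Fin (m + 1)) (Fin (m + 1)) ℝ := Fin.insertNth v
      (Fin.insertNth w₂ (1 - ∑ i, if R (v.succAbove i) w₂ then X i c else 0)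
        (fun j => if j = c then
          1 - ∑ i, (if R (v.succAbove i) (w₂.succAbove c) then X i c else 0) else 0))
      (fun i => Fin.insertNth w₂ (if R (v.succAbove i) w₂ then X i c else 0)
        (fun j => if R (v.succAbove i) (w₂.succAbove j) then X i j else 0))
    have M_v_w : M v w₂ = 1 - ∑ i, if R (v.succAbove i) w₂ then X i c else 0 := by simp [M]
    have M_v : ∀ j, M v (w₂.succAbove j) = if j = c then
        1 - ∑ i, (if R (v.succAbove i) (w₂.succAbove c) then X i c else 0) else 0 := by simp [M]
    have M_w : ∀ i, M (v.succAbove i) w₂ = if R (v.succAbove i) w₂ then X i c else 0 := by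
      simp [M]
    have M_s : ∀ i j, M (v.succAbove i) (w₂.succAbove j) =
        if R (v.succAbove i) (w₂.succAbove j) then X i j else 0 := by simp [M]
    have hfM : f M = X := by
      ext i j
      rw [f_apply, M_s, M_w]
      have h0 : X i j ≠ 0 → _ := hXR i j
      by_cases hj : j = c
      · subst hj
        by_cases h1 : R (v.succAbove i) (w₂.succAbove j)
        · simp [h1, hu _ (Fin.succAbove_ne v i) h1]
        · by_cases h2 : R (v.succAbove i) w₂
          · simp [h1, h2]
          · simp only [h1, h2, if_false, if_true, add_zero]
            by_contra h
            rcases h0 (Ne.symm h) with h | h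
            · exact h1 h
            · exact h2 h.2
      · by_cases h1 : R (v.succAbove i) (w₂.succAbove j)
        · simp [h1, hj]
        · simp only [h1, hj, if_false, add_zero]
          by_contra h
          rcases h0 (Ne.symm h) with h | h
          · exact h1 h
          · exact hj h.1
    have hle : ∀ p : Fin m → Prop, ∑ i, (if p i then X i c else 0) ≤ 1 := fun p => by
      rw [← hX.2.2 c]
      refine Finset.sum_le_sum fun i _ => ?_
      split_ifs
      exacts [le_rfl, hX.1 i c]
    have hsum : ∑ i, (if R (v.succAbove i) (w₂.succAbove c) then X i c else 0) +
        ∑ i, (if R (v.succAbove i) w₂ then X i c else 0) = 1 := by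
      rw [← hX.2.2 c, ← Finset.sum_add_distrib, ← hfM]
      refine Finset.sum_congr rfl fun i _ => ?_
      rw [hfM]
      conv_rhs => rw [← hfM]
      rw [f_apply, M_s, M_w, if_pos rfl]
    refine ⟨M, (hF M).2 ⟨mem_doublyStochastic_iff_sum.2 ⟨fun i j => ?_, fun i => ?_, fun j => ?_⟩,
      fun i j h => ?_⟩, hfM⟩
    · rcases Fin.eq_self_or_eq_succAbove v i with rfl | ⟨i, rfl⟩ <;>
        rcases Fin.eq_self_or_eq_succAbove w₂ j with rfl | ⟨j, rfl⟩
      · rw [M_v_w]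
        linarith [hle fun k => R (i.succAbove k) j]
      · rw [M_v]
        split_ifs
        · linarith [hle fun k => R (i.succAbove k) (w₂.succAbove c)]
        · exact le_rfl
      · rw [M_w]
        split_ifs
        exacts [hX.1 _ _, le_rfl]
      · rw [M_s]
        split_ifs
        exacts [hX.1 _ _, le_rfl]
    · rcases Fin.eq_self_or_eq_succAbove v i with rfl | ⟨i, rfl⟩
      · rw [Fin.sum_univ_succAbove _ w₂, M_v_w, Finset.sum_congr rfl fun j _ => M_v j]
        simp only [Finset.sum_ite_eq', Finset.mem_univ, if_true]
        linarith
      · rw [← f_row, hfM, hX.2.1]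
    · rw [Fin.sum_univ_succAbove _ v]
      rcases Fin.eq_self_or_eq_succAbove w₂ j with rfl | ⟨j, rfl⟩
      · rw [M_v_w, Finset.sum_congr rfl fun i _ => M_w i]
        ring
      · rw [M_v, Finset.sum_congr rfl fun i _ => M_s i j]
        by_cases hj : j = c
        · subst hj
          rw [if_pos rfl]
          ring
        · rw [if_neg hj, zero_add, ← hX.2.2 j]
          refine Finset.sum_congr rfl fun i _ => ?_
          conv_rhs => rw [← hfM]
          rw [f_apply, M_s, if_neg hj, add_zero]
    · rcases Fin.eq_self_or_eq_succAbove v i with rfl | ⟨i, rfl⟩ <;>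
        rcases Fin.eq_self_or_eq_succAbove w₂ j with rfl | ⟨j, rfl⟩
      · exact hv₂
      · rw [M_v] at h
        split_ifs at h with hj
        · rw [hj]
          exact hv₁
        · exact absurd rfl h
      · rw [M_w] at h
        by_contra hR
        exact h (if_neg hR)
      · rw [M_s] at h
        by_contra hR
        exact h (if_neg hR)

/-- The doubly stochastic matrices supported on `d` disjoint `2 × 2` blocks form a `d`-cube. -/
theorem nonempty_facesOf_orderIso_cube {ι C : Type*} [Fintype ι] [DecidableEq ι] [Fintype C]
    [DecidableEq C] {F : Set (Matrix ι ι ℝ)} {d : ℕ} (κ μ : ι → C)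
    (hF : ∀ M, M ∈ F ↔ M ∈ doublyStochastic ℝ ι ∧ ∀ i j, M i j ≠ 0 → κ i = μ j)
    (hκ : ∀ c, (Finset.univ.filter fun i => κ i = c).card = 2)
    (hμ : ∀ c, (Finset.univ.filter fun j => μ j = c).card = 2) (hC : Fintype.card C = d) :
    Nonempty (↥(facesOf F) ≃o ↥(facesOf (Set.Icc (0 : Fin d → ℝ) 1))) := by
  have label : ∀ g : ι → C, (∀ c, (Finset.univ.filter fun i => g i = c).card = 2) →
      ∃ e : ι ≃ C × Bool, ∀ i, (e i).1 = g i := by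
    intro g hg
    have hfib : ∀ c, Nonempty ({i // g i = c} ≃ Bool) := fun c =>
      ⟨Fintype.equivOfCardEq (by rw [Fintype.card_subtype, hg]; rfl)⟩
    let b := fun c => (hfib c).some
    exact ⟨(Equiv.sigmaFiberEquiv g).symm.trans
      ((Equiv.sigmaCongrRight b).trans (Equiv.sigmaEquivProd C Bool)), fun i => rfl⟩
  obtain ⟨e, he⟩ := label κ hκ
  obtain ⟨e', he'⟩ := label μ hμ
  let φ : Fin d ≃ C := (Fintype.equivFinOfCardEq hC).symm
  let f : Matrix ι ι ℝ →ₗ[ℝ] (Fin d → ℝ) :=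
    { toFun := fun M k => M (e.symm (φ k, false)) (e'.symm (φ k, false))
      map_add' := fun _ _ => rfl
      map_smul' := fun _ _ => rfl }
  have f_apply : ∀ M k, f M k = M (e.symm (φ k, false)) (e'.symm (φ k, false)) := fun _ _ => rfl
  have row_sum : ∀ M : Matrix ι ι ℝ, (∀ i j, M i j ≠ 0 → κ i = μ j) → ∀ c a,
      ∑ j, M (e.symm (c, a)) j =
        M (e.symm (c, a)) (e'.symm (c, true)) + M (e.symm (c, a)) (e'.symm (c, false)) := by
    intro M hM c a
    rw [← Equiv.sum_comp e'.symm, Fintype.sum_prod_type, Finset.sum_eq_single c]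
    · exact Fintype.sum_bool _
    · intro c' _ hc'
      refine Finset.sum_eq_zero fun b _ => ?_
      by_contra h
      have := hM _ _ h
      rw [← he, ← he'] at this
      simp at this
      exact hc' this.symm
    · simp
  have col_sum : ∀ M : Matrix ι ι ℝ, (∀ i j, M i j ≠ 0 → κ i = μ j) → ∀ c a,
      ∑ i, M i (e'.symm (c, a)) =
        M (e.symm (c, true)) (e'.symm (c, a)) + M (e.symm (c, false)) (e'.symm (c, a)) := by
    intro M hM c a
    rw [← Equiv.sum_comp e.symm, Fintype.sum_prod_type, Finset.sum_eq_single c]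
    · exact Fintype.sum_bool _
    · intro c' _ hc'
      refine Finset.sum_eq_zero fun b _ => ?_
      by_contra h
      have := hM _ _ h
      rw [← he, ← he'] at this
      simp at this
      exact hc' this
    · simp
  let g : (Fin d → ℝ) → Matrix ι ι ℝ := fun x i j =>
    if κ i = μ j then
      if (e i).2 = (e' j).2 then x (φ.symm (κ i)) else 1 - x (φ.symm (κ i)) else 0
  have g_supp : ∀ x i j, g x i j ≠ 0 → κ i = μ j := fun x i j h => by
    by_contra hne
    exact h (if_neg hne)
  have g_apply : ∀ x c a b, g x (e.symm (c, a)) (e'.symm (c, b)) =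
      if a = b then x (φ.symm c) else 1 - x (φ.symm c) := by
    intro x c a b
    simp [g, ← he, ← he']
  have eq_g : ∀ M ∈ F, M = g (f M) := by
    intro M hM
    obtain ⟨hMd, hMs⟩ := (hF M).1 hM
    rw [mem_doublyStochastic_iff_sum] at hMd
    ext i j
    by_cases hij : κ i = μ j
    · obtain ⟨⟨c, a⟩, rfl⟩ := e.symm.surjective i
      obtain ⟨⟨c', b⟩, rfl⟩ := e'.symm.surjective j
      rw [← he, ← he'] at hij
      simp only [Equiv.apply_symm_apply] at hij
      subst hij
      rw [g_apply, f_apply, Equiv.apply_symm_apply]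
      have h1 := hMd.2.1 (e.symm (c, false))
      have h2 := hMd.2.1 (e.symm (c, true))
      have h3 := hMd.2.2 (e'.symm (c, false))
      rw [row_sum M hMs] at h1 h2
      rw [col_sum M hMs] at h3
      cases a <;> cases b <;> simp <;> linarith
    · rw [not_not.1 (mt (g_supp (f M) i j) hij), not_not.1 (mt (hMs i j) hij)]
  have f_g : ∀ x, f (g x) = x := fun x => by
    ext k
    rw [f_apply, g_apply, if_pos rfl, Equiv.symm_apply_apply]
  have himage : f '' F = Set.Icc (0 : Fin d → ℝ) 1 := by
    ext x
    constructor
    · rintro ⟨M, hM, rfl⟩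
      have hMd := ((hF M).1 hM).1
      exact ⟨fun k => hMd.1 _ _, fun k => le_one_of_mem_doublyStochastic hMd⟩
    · rintro ⟨h0, h1⟩
      refine ⟨g x, (hF _).2 ⟨mem_doublyStochastic_iff_sum.2 ⟨fun i j => ?_, fun i => ?_, fun j => ?_⟩,
        g_supp x⟩, f_g x⟩
      · have h0' := h0 (φ.symm (κ i))
        have h1' := h1 (φ.symm (κ i))
        simp only [Pi.zero_apply, Pi.one_apply] at h0' h1'
        simp only [g]
        split_ifs <;> linarith
      · obtain ⟨⟨c, a⟩, rfl⟩ := e.symm.surjective i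
        rw [row_sum _ (g_supp x), g_apply, g_apply]
        cases a <;> simp
      · obtain ⟨⟨c, a⟩, rfl⟩ := e'.symm.surjective j
        rw [col_sum _ (g_supp x), g_apply, g_apply]
        cases a <;> simp
  rw [← himage]
  refine nonempty_facesOf_orderIso_image f (mem_facesOf_doublyStochastic_of_support hF).1 ?_
  intro M hM M' hM' h
  rw [eq_g M hM, eq_g M' hM', h]

/-- In a face that is not combinatorially a face of a smaller Birkhoff polytope, a row supported
in two columns meets both of them, and some other row meets both of them as well. -/
theorem ne_zero_and_exists_of_minimal {n : ℕ} {F : Set (Matrix (Fin n) (Fin n) ℝ)}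
    {A : Matrix (Fin n) (Fin n) ℝ} (hA : A ∈ F)
    (hF : ∀ M, M ∈ F ↔ M ∈ doublyStochastic ℝ (Fin n) ∧ ∀ i j, M i j ≠ 0 → A i j ≠ 0)
    (hmin : ∀ m < n, ∀ F' ∈ facesOf (doublyStochastic ℝ (Fin m) : Set (Matrix (Fin m) (Fin m) ℝ)),
      ¬ Nonempty (↥(facesOf F) ≃o ↥(facesOf F')))
    {v w₁ w₂ : Fin n} (hw : w₁ ≠ w₂) (hv : ∀ j, A v j ≠ 0 → j = w₁ ∨ j = w₂) (hv₁ : A v w₁ ≠ 0) :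
    A v w₂ ≠ 0 ∧ ∃ u, u ≠ v ∧ A u w₁ ≠ 0 ∧ A u w₂ ≠ 0 := by
  obtain _ | m := n
  · exact v.elim0
  have hAd := ((hF A).1 hA).1
  have hv₂ : A v w₂ ≠ 0 := by
    intro h0
    have hcol : ∀ u, u ≠ v → A u w₁ = 0 := fun u hu =>
      eq_zero_of_card_le hAd {v} {w₁} (fun i hi j hj => by
        rw [Finset.mem_singleton] at hi ⊢
        subst hi
        rcases hv j hj with h | h
        · exact h
        · exact absurd (h ▸ h0) hj) (by simp) (by simpa using hu) (by simp)
    have hF₂ : ∀ M, M ∈ F ↔ M ∈ doublyStochastic ℝ (Fin (m + 1)) ∧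
        ∀ i j, M i j ≠ 0 → A i j ≠ 0 ∨ i = v ∧ j = w₂ := fun M => by
      rw [hF]
      refine and_congr_right fun hM => ⟨fun h i j hij => Or.inl (h i j hij), fun h i j hij => ?_⟩
      rcases h i j hij with h' | ⟨rfl, rfl⟩
      · exact h'
      · have hz : ∀ u, u ≠ i → M u w₁ = 0 := fun u hu => by
          by_contra hne
          simpa [hcol u hu, hu] using h u w₁ hne
        have h1 := sum_col_of_mem_doublyStochastic hM w₁
        rw [Finset.sum_eq_single i (fun u _ hu => hz u hu) (by simp)] at h1
        have h2 := Finset.add_le_sum (f := M i) (fun k _ => hM.1 i k) (Finset.mem_univ w₁)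
          (Finset.mem_univ j) hw
        rw [sum_row_of_mem_doublyStochastic hM i] at h2
        exact absurd (le_antisymm (by linarith) (hM.1 i j)) hij
    obtain ⟨F', hF', h⟩ := exists_orderIso_of_reducible hw hF₂
      (fun j hj => hj.elim (hv j) fun h => Or.inr h.2) (Or.inl hv₁) (Or.inr ⟨rfl, rfl⟩)
      (fun u hu h => by simp [hcol u hu, hu] at h)
    exact hmin m m.lt_succ_self F' hF' h
  refine ⟨hv₂, ?_⟩
  by_contra! hu
  obtain ⟨F', hF', h⟩ := exists_orderIso_of_reducible hw hF hv hv₁ hv₂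
    (fun u huv h => not_not.2 (hu u huv h))
  exact hmin m m.lt_succ_self F' hF' h

/-- A nonempty `d`-dimensional face of the Birkhoff polytope of order `2d` that is not
combinatorially a face of a smaller one is a `d`-cube. -/
theorem nonempty_orderIso_cube_of_minimal {n d : ℕ} (hd : 1 ≤ d) (hn : n = 2 * d)
    {F : Set (Matrix (Fin n) (Fin n) ℝ)} (hne : F.Nonempty)
    (hF : F ∈ facesOf (doublyStochastic ℝ (Fin n) : Set (Matrix (Fin n) (Fin n) ℝ)))
    (hdim : Module.finrank ℝ ↥(vectorSpan ℝ F) = d)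
    (hmin : ∀ m < n, ∀ F' ∈ facesOf (doublyStochastic ℝ (Fin m) : Set (Matrix (Fin m) (Fin m) ℝ)),
      ¬ Nonempty (↥(facesOf F) ≃o ↥(facesOf F'))) :
    Nonempty (↥(facesOf F) ≃o ↥(facesOf (Set.Icc (0 : Fin d → ℝ) 1))) := by
  classical
  obtain ⟨A, hA, hpos⟩ := exists_pos_of_mem_facesOf hne hF
  have hsupp := mem_face_iff_support hF hA hpos
  have hAd : A ∈ doublyStochastic ℝ (Fin n) := hF.2.1 hA
  have row_nonempty : ∀ i, ∃ j, A i j ≠ 0 := fun i => by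
    by_contra! h
    simpa [h] using sum_row_of_mem_doublyStochastic hAd i
  have col_nonempty : ∀ j, ∃ i, A i j ≠ 0 := fun j => by
    by_contra! h
    simpa [h] using sum_col_of_mem_doublyStochastic hAd j
  have hred := @ne_zero_and_exists_of_minimal n F A hA hsupp hmin
  let N : Fin n → Finset (Fin n) := fun i => Finset.univ.filter fun j => A i j ≠ 0
  have mem_N : ∀ i j, j ∈ N i ↔ A i j ≠ 0 := fun i j => by simp [N]
  let r : Fin n → Fin n → Prop := fun i i' => ∃ j, A i j ≠ 0 ∧ A i' j ≠ 0
  let κ : Fin n → Quotient (Relation.EqvGen.setoid r) := Quotient.mk _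
  choose row hrow using col_nonempty
  let μ : Fin n → Quotient (Relation.EqvGen.setoid r) := fun j => κ (row j)
  have hκ : Function.Surjective κ := Quotient.mk_surjective
  have hκμ : ∀ i j, A i j ≠ 0 → κ i = μ j := fun i j h =>
    Quotient.sound (Relation.EqvGen.rel _ _ ⟨j, h, hrow j⟩)
  have hcard := card_support_add_card_le_finrank_add hA hAd
    (fun M hM h => (hsupp M).2 ⟨hM, h⟩) κ μ hκ hκμ
  have hedges : Nat.card {p : Fin n × Fin n // A p.1 p.2 ≠ 0} = ∑ i, (N i).card := by
    rw [Nat.card_eq_fintype_card, Fintype.card_subtype, ← Finset.univ_product_univ,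
      Finset.card_filter, Finset.sum_product]
    simp only [N, Finset.card_filter]
  rw [hedges, hdim] at hcard
  obtain ⟨hC, hmem, hκ2, hμ2⟩ := components_of_card_eq N κ μ (d := d)
    (fun S T h => card_le_of_support hAd S T fun i hi j hj => h i hi ((mem_N i j).2 hj))
    (fun S T h hTS i hi i' hii' => by
      have step : ∀ a b, r a b → a ∈ S → b ∈ S := by
        rintro a b ⟨j, ha, hb⟩ haS
        by_contra hbS
        exact hb (eq_zero_of_card_le hAd S T (fun i hi j hj => h i hi ((mem_N i j).2 hj)) hTS hbS
          (h a haS ((mem_N a j).2 ha)))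
      have hclosed : ∀ a b, Relation.EqvGen r a b → (a ∈ S ↔ b ∈ S) := fun a b hab => by
        induction hab with
        | rel a b h => exact ⟨step a b h, step b a (by obtain ⟨j, h1, h2⟩ := h; exact ⟨j, h2, h1⟩)⟩
        | refl => rfl
        | symm _ _ _ ih => exact ih.symm
        | trans _ _ _ _ _ ih ih' => exact ih.trans ih'
      exact (hclosed i i' (Quotient.exact hii')).1 hi)
    (fun i => by
      obtain ⟨j, hj⟩ := row_nonempty i
      by_contra! hlt
      have h1 : N i = {j} := by
        refine (Finset.eq_of_subset_of_card_le ?_ ?_).symm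
        · simpa [mem_N] using hj
        · rw [Finset.card_singleton]
          omega
      have : Nontrivial (Fin n) := Fin.nontrivial_iff_two_le.2 (by omega)
      obtain ⟨j', hj'⟩ := exists_ne j
      have h2 := (hred hj'.symm (fun k hk => Or.inl (by simpa [h1] using (mem_N i k).2 hk)) hj).1
      exact hj' (by simpa [h1] using (mem_N i j').2 h2))
    (fun v hv => by
      obtain ⟨w₁, w₂, hw, hN⟩ := Finset.card_eq_two.1 hv
      obtain ⟨-, u, huv, h1, h2⟩ := hred hw
        (fun k hk => by simpa [hN] using (mem_N v k).2 hk)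
        ((mem_N v w₁).1 (by simp [hN]))
      refine ⟨u, huv, fun j hj => (mem_N u j).2 ?_⟩
      rw [hN, Finset.mem_insert, Finset.mem_singleton] at hj
      rcases hj with rfl | rfl
      exacts [h1, h2])
    hκ (fun i j h => hκμ i j ((mem_N i j).1 h)) (fun j => ⟨row j, (mem_N _ _).2 (hrow j)⟩)
    (by simpa using hn) hcard
  refine nonempty_facesOf_orderIso_cube κ μ (fun M => ?_) hκ2 hμ2 hC
  rw [hsupp]
  refine and_congr_right fun _ => forall₃_congr fun i j _ => ⟨hκμ i j, fun h => ?_⟩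
  exact (mem_N i j).1 (hmem i j h)

/-- A `d`-dimensional combinatorial type of Birkhoff face with Birkhoff dimension
`2d` is a `d`-cube. -/
theorem stmt15 (d : ℕ) (hd : 1 ≤ d)
    (F : Set (Matrix (Fin (2 * d)) (Fin (2 * d)) ℝ))
    (hne : F.Nonempty) (hconv : Convex ℝ F)
    (hext : IsExtreme ℝ
      (doublyStochastic ℝ (Fin (2 * d)) : Set (Matrix (Fin (2 * d)) (Fin (2 * d)) ℝ)) F)
    (hdim : Module.finrank ℝ ↥(vectorSpan ℝ F) = d)
    (hmin : ∀ m < 2 * d, ∀ F' : Set (Matrix (Fin m) (Fin m) ℝ),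
      Convex ℝ F' →
      IsExtreme ℝ (doublyStochastic ℝ (Fin m) : Set (Matrix (Fin m) (Fin m) ℝ)) F' →
      ¬ Nonempty (↥(facesOf F) ≃o ↥(facesOf F'))) :
    Nonempty (↥(facesOf F) ≃o ↥(facesOf (Set.Icc (0 : Fin d → ℝ) 1))) := by
  exact nonempty_orderIso_cube_of_minimal hd rfl hne ⟨hconv, hext⟩ hdim
    fun m hm F' hF' => hmin m hm F' hF'.1 hF'.2
end

section
/- Let d ≥ 2 and let F be a nonempty face (convex extreme subset) of the Birkhoff polytope B_{2d−1} with Module.finrank ℝ ↥(vectorSpan ℝ F) = d. Suppose that for every m < 2d − 1, no face of B_m is combinatorially isomorphic to F (i.e. F has Birkhoff dimension 2d − 1). Then F is combinatorially isomorphic to the product of a (d−2)-cube and a triangle: there is an order isomorphism between the face poset of F and the face poset of (Set.Icc (0 : Fin (d−2) → ℝ) 1) ×ˢ (stdSimplex ℝ (Fin 3)). -/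
section FacePoset

variable {E E' : Type*} [AddCommGroup E] [Module ℝ E] [AddCommGroup E'] [Module ℝ E']

/-- A linear map which restricts to a bijection from a convex set `P` onto `Q` induces an
isomorphism of face posets. -/
lemma nonempty_facesOf_orderIso {P : Set E} {Q : Set E'} (f : E →ₗ[ℝ] E') (hP : Convex ℝ P)
    (hinj : Set.InjOn f P) (himg : f '' P = Q) : Nonempty (facesOf P ≃o facesOf Q) := by
  have hmaps : ∀ x ∈ P, f x ∈ Q := fun x hx => himg ▸ Set.mem_image_of_mem f hx
  have hseg : ∀ x y z : E, z ∈ openSegment ℝ x y → f z ∈ openSegment ℝ (f x) (f y) := by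
    rintro x y z ⟨a, b, ha, hb, hab, rfl⟩
    exact ⟨a, b, ha, hb, hab, by simp⟩
  have himage : ∀ S ∈ facesOf P, f '' S ∈ facesOf Q := by
    rintro S ⟨hSc, hSe⟩
    refine ⟨hSc.is_linear_image f.isLinear, ⟨himg ▸ Set.image_mono hSe.subset, ?_⟩⟩
    rw [← himg]
    rintro _ ⟨x, hx, rfl⟩ _ ⟨y, hy, rfl⟩ _ ⟨s, hs, rfl⟩ ⟨a, b, ha, hb, hab, hs'⟩
    refine ⟨x, hSe.left_mem_of_mem_openSegment hx hy hs ⟨a, b, ha, hb, hab, ?_⟩, rfl⟩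
    exact hinj (hP hx hy ha.le hb.le hab) (hSe.subset hs) (by simpa using hs')
  have hpreimage : ∀ T ∈ facesOf Q, P ∩ f ⁻¹' T ∈ facesOf P := by
    rintro T ⟨hTc, hTe⟩
    refine ⟨hP.inter (hTc.linear_preimage f), ⟨Set.inter_subset_left, ?_⟩⟩
    rintro x hx y hy z ⟨-, hz⟩ hxyz
    exact ⟨hx, hTe.left_mem_of_mem_openSegment (hmaps x hx) (hmaps y hy) hz (hseg x y z hxyz)⟩
  refine ⟨{
    toFun := fun S => ⟨f '' S, himage S S.2⟩
    invFun := fun T => ⟨P ∩ f ⁻¹' T, hpreimage T T.2⟩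
    left_inv := ?_
    right_inv := ?_
    map_rel_iff' := ?_ }⟩
  · rintro ⟨S, hS⟩
    refine Subtype.ext (Set.Subset.antisymm ?_ ?_)
    · rintro x ⟨hx, s, hs, hsx⟩
      exact hinj (hS.2.subset hs) hx hsx ▸ hs
    · exact fun x hx => ⟨hS.2.subset hx, x, hx, rfl⟩
  · rintro ⟨T, hT⟩
    refine Subtype.ext (Set.Subset.antisymm ?_ ?_)
    · rintro _ ⟨x, ⟨-, hx⟩, rfl⟩
      exact hx
    · intro y hy
      obtain ⟨x, hx, rfl⟩ : y ∈ f '' P := himg ▸ hT.2.subset hy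
      exact ⟨x, ⟨hx, hy⟩, rfl⟩
  · rintro ⟨S, hS⟩ ⟨T, hT⟩
    exact hinj.image_subset_image_iff hS.2.subset hT.2.subset

end FacePoset

section SupportPolytope

variable {I J : Type*} [Fintype I] [Fintype J]

/-- The polytope of nonnegative matrices with row and column sums `1` whose row `i` is supported
on `N i`. -/
def supportPolytope (N : I → Finset J) : Set (Matrix I J ℝ) :=
  {M | (∀ i j, 0 ≤ M i j) ∧ (∀ i, ∀ j ∉ N i, M i j = 0) ∧
    (∀ i, ∑ j, M i j = 1) ∧ ∀ j, ∑ i, M i j = 1}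

lemma convex_supportPolytope (N : I → Finset J) : Convex ℝ (supportPolytope N) := by
  rintro x ⟨hx, hx0, hxr, hxc⟩ y ⟨hy, hy0, hyr, hyc⟩ a b ha hb hab
  refine ⟨fun i j => ?_, fun i j hj => ?_, fun i => ?_, fun j => ?_⟩
  · exact add_nonneg (mul_nonneg ha (hx i j)) (mul_nonneg hb (hy i j))
  · simp [hx0 i j hj, hy0 i j hj]
  · simp [Finset.sum_add_distrib, ← Finset.mul_sum, hxr, hyr, hab]
  · simp [Finset.sum_add_distrib, ← Finset.mul_sum, hxc, hyc, hab]

lemma isExtreme_supportPolytope {n : Type*} [Fintype n] [DecidableEq n] (N : n → Finset n) :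
    IsExtreme ℝ (doublyStochastic ℝ n : Set (Matrix n n ℝ)) (supportPolytope N) := by
  constructor
  · rintro M ⟨h, -, hr, hc⟩
    exact mem_doublyStochastic_iff_sum.2 ⟨h, hr, hc⟩
  · rintro x hx y hy z ⟨-, hz, -⟩ ⟨a, b, ha, hb, hab, rfl⟩
    obtain ⟨hx0, hxr, hxc⟩ := mem_doublyStochastic_iff_sum.1 hx
    obtain ⟨hy0, -, -⟩ := mem_doublyStochastic_iff_sum.1 hy
    refine ⟨hx0, fun i j hj => ?_, hxr, hxc⟩
    have h : a * x i j + b * y i j = 0 := hz i j hj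
    have h1 := mul_nonneg ha.le (hx0 i j)
    have h2 := mul_nonneg hb.le (hy0 i j)
    have h3 : a * x i j = 0 := by linarith
    exact (mul_eq_zero.1 h3).resolve_left ha.ne'

/-- A bijective reindexing of rows and columns preserves the face poset. -/
lemma nonempty_facesOf_orderIso_reindex {I' J' : Type*} [Fintype I'] [Fintype J']
    (N : I → Finset J) (N' : I' → Finset J') (e : I' ≃ I) (e' : J' ≃ J)
    (hN : ∀ i j, j ∈ N' i ↔ e' j ∈ N (e i)) :
    Nonempty (facesOf (supportPolytope N) ≃o facesOf (supportPolytope N')) := by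
  refine nonempty_facesOf_orderIso
    { toFun := fun M => M.submatrix e e', map_add' := fun _ _ => rfl, map_smul' := fun _ _ => rfl }
    (convex_supportPolytope N) ?_ ?_
  · intro x _ y _ hxy
    ext i j
    have h : x (e (e.symm i)) (e' (e'.symm j)) = y (e (e.symm i)) (e' (e'.symm j)) :=
      congrFun (congrFun hxy (e.symm i)) (e'.symm j)
    simpa using h
  · apply Set.Subset.antisymm
    · rintro _ ⟨M, ⟨h, h0, hr, hc⟩, rfl⟩
      refine ⟨fun i j => h _ _, fun i j hj => h0 _ _ (mt (hN i j).2 hj), fun i => ?_, fun j => ?_⟩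
      · exact (Equiv.sum_comp e' fun j => M (e i) j).trans (hr _)
      · exact (Equiv.sum_comp e fun i => M i (e' j)).trans (hc _)
    · rintro M ⟨h, h0, hr, hc⟩
      refine ⟨M.submatrix e.symm e'.symm, ⟨fun i j => h _ _, fun i j hj => h0 _ _ ?_, fun i => ?_,
        fun j => ?_⟩, ?_⟩
      · rw [hN]
        simpa using hj
      · exact (Equiv.sum_comp e'.symm fun j => M (e.symm i) j).trans (hr _)
      · exact (Equiv.sum_comp e.symm fun i => M i (e'.symm j)).trans (hc _)
      · ext i j
        change M (e.symm (e i)) (e'.symm (e' j)) = M i j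
        simp

/-- Every support polytope on `m` rows and `m` columns has the face poset of a face of the `m`-th
Birkhoff polytope. -/
lemma exists_face_doublyStochastic [DecidableEq J] {m : ℕ} (hI : Fintype.card I = m)
    (hJ : Fintype.card J = m) (N : I → Finset J) :
    ∃ F' : Set (Matrix (Fin m) (Fin m) ℝ), Convex ℝ F' ∧
      IsExtreme ℝ (doublyStochastic ℝ (Fin m) : Set (Matrix (Fin m) (Fin m) ℝ)) F' ∧
      Nonempty (facesOf (supportPolytope N) ≃o facesOf F') := by
  let e := (Fintype.equivFinOfCardEq hI).symm
  let e' := (Fintype.equivFinOfCardEq hJ).symm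
  refine ⟨supportPolytope fun i => Finset.univ.filter fun j => e' j ∈ N (e i),
    convex_supportPolytope _, isExtreme_supportPolytope _,
    nonempty_facesOf_orderIso_reindex _ _ e e' (by simp)⟩

/-- Deleting the row and column of a forced entry preserves the face poset. -/
lemma nonempty_facesOf_orderIso_delete [DecidableEq I] [DecidableEq J] (N : I → Finset J)
    {i₀ : I} {j₀ : J} (h₀ : N i₀ = {j₀}) :
    Nonempty (facesOf (supportPolytope N) ≃o
      facesOf (supportPolytope fun i : {i // i ≠ i₀} => (N i).subtype (· ≠ j₀))) := by
  have key : ∀ M ∈ supportPolytope N, M i₀ j₀ = 1 ∧ (∀ j ≠ j₀, M i₀ j = 0) ∧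
      ∀ i ≠ i₀, M i j₀ = 0 := by
    rintro M ⟨h, h0, hr, hc⟩
    have h1 : ∀ j ≠ j₀, M i₀ j = 0 := fun j hj => h0 _ _ (by simp [h₀, hj])
    have h2 : M i₀ j₀ = 1 := by
      rw [← hr i₀, Fintype.sum_eq_single j₀ h1]
    have h3 := hc j₀
    rw [Fintype.sum_eq_add_sum_subtype_ne _ i₀, h2, add_eq_left,
      Finset.sum_eq_zero_iff_of_nonneg fun i _ => h _ _] at h3
    exact ⟨h2, h1, fun i hi => h3 ⟨i, hi⟩ (Finset.mem_univ _)⟩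
  refine nonempty_facesOf_orderIso
    { toFun := fun M => M.submatrix Subtype.val Subtype.val, map_add' := fun _ _ => rfl,
      map_smul' := fun _ _ => rfl }
    (convex_supportPolytope N) ?_ ?_
  · intro x hx y hy hxy
    obtain ⟨hx1, hx2, hx3⟩ := key x hx
    obtain ⟨hy1, hy2, hy3⟩ := key y hy
    ext i j
    by_cases hi : i = i₀ <;> by_cases hj : j = j₀
    · rw [hi, hj, hx1, hy1]
    · rw [hi, hx2 j hj, hy2 j hj]
    · rw [hj, hx3 i hi, hy3 i hi]
    · exact congrFun (congrFun hxy ⟨i, hi⟩) ⟨j, hj⟩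
  · apply Set.Subset.antisymm
    · rintro _ ⟨M, hM, rfl⟩
      obtain ⟨hM1, hM2, hM3⟩ := key M hM
      obtain ⟨h, h0, hr, hc⟩ := hM
      refine ⟨fun i j => h _ _, fun i j hj => h0 _ _ (by simpa using hj), fun i => ?_, fun j => ?_⟩
      · have h4 := hr i
        rwa [Fintype.sum_eq_add_sum_subtype_ne _ j₀, hM3 i i.2, zero_add] at h4
      · have h4 := hc j
        rwa [Fintype.sum_eq_add_sum_subtype_ne _ i₀, hM2 j j.2, zero_add] at h4
    · rintro M ⟨h, h0, hr, hc⟩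
      let X : Matrix I J ℝ := fun i j =>
        if hi : i = i₀ then if j = j₀ then 1 else 0
        else if hj : j = j₀ then 0 else M ⟨i, hi⟩ ⟨j, hj⟩
      have hX : ∀ (i : {i // i ≠ i₀}) (j : {j // j ≠ j₀}), X i j = M i j := by
        rintro ⟨i, hi⟩ ⟨j, hj⟩
        simp [X, hi, hj]
      refine ⟨X, ⟨fun i j => ?_, fun i j hj => ?_, fun i => ?_, fun j => ?_⟩, ?_⟩
      · dsimp only [X]
        split_ifs
        exacts [zero_le_one, le_rfl, le_rfl, h _ _]
      · dsimp only [X]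
        split_ifs with hi hj' hj'
        · exact absurd hj (by simp [hi, hj', h₀])
        · rfl
        · rfl
        · exact h0 _ _ (by simpa using hj)
      · rw [Fintype.sum_eq_add_sum_subtype_ne _ j₀]
        by_cases hi : i = i₀
        · have : ∀ j : {j // j ≠ j₀}, X i j = 0 := fun j => by simp [X, hi, j.2]
          simp [this]
          simp [X, hi]
        · rw [Finset.sum_congr rfl fun j _ => hX ⟨i, hi⟩ j, hr]
          simp [X, hi]
      · rw [Fintype.sum_eq_add_sum_subtype_ne _ i₀]
        by_cases hj : j = j₀
        · have : ∀ i : {i // i ≠ i₀}, X i j = 0 := fun i => by simp [X, hj, i.2]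
          simp [this]
          simp [X, hj]
        · rw [Finset.sum_congr rfl fun i _ => hX i ⟨j, hj⟩, hc]
          simp [X, hj]
      · ext i j
        exact hX i j

/-- Contracting a node of degree two whose neighbours have no other common neighbour preserves
the face poset. -/
lemma nonempty_facesOf_orderIso_contract [DecidableEq I] [DecidableEq J] (N : I → Finset J)
    {v : I} {w₁ w₂ : J} (hw : w₁ ≠ w₂) (hv : N v = {w₁, w₂})
    (hred : ∀ u ≠ v, ¬(w₁ ∈ N u ∧ w₂ ∈ N u)) :
    Nonempty (facesOf (supportPolytope N) ≃o
      facesOf (supportPolytope fun i : {i // i ≠ v} =>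
        (if w₂ ∈ N i then insert w₁ (N i) else N i).subtype (· ≠ w₂))) := by
  have hrow : ∀ M ∈ supportPolytope N, M v w₁ + M v w₂ = 1 := by
    rintro M ⟨h, h0, hr, hc⟩
    rw [← hr v, ← Finset.sum_pair hw]
    refine Finset.sum_subset (Finset.subset_univ _) fun j _ hj => h0 _ _ (hv ▸ hj)
  have hcol : ∀ M ∈ supportPolytope N, ∀ j, M v j = 1 - ∑ i : {i // i ≠ v}, M i j := by
    rintro M ⟨h, h0, hr, hc⟩ j
    rw [← hc j, Fintype.sum_eq_add_sum_subtype_ne _ v]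
    ring
  let f : Matrix I J ℝ →ₗ[ℝ] Matrix {i // i ≠ v} {j // j ≠ w₂} ℝ :=
    { toFun := fun M i j => M i j + if j = w₁ then M i w₂ else 0
      map_add' := fun x y => by
        ext i j
        change x i j + y i j + (if (j : J) = w₁ then x i w₂ + y i w₂ else 0) =
          (x i j + if (j : J) = w₁ then x i w₂ else 0) + (y i j + if (j : J) = w₁ then y i w₂ else 0)
        split_ifs <;> ring
      map_smul' := fun c x => by
        ext i j
        change c * x i j + (if (j : J) = w₁ then c * x i w₂ else 0) =
          c * (x i j + if (j : J) = w₁ then x i w₂ else 0)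
        split_ifs <;> ring }
  have hf : ∀ M i j, f M i j = M i j + if (j : J) = w₁ then M i w₂ else 0 := fun _ _ _ => rfl
  have hf₁ : ∀ (M : Matrix I J ℝ) (i : {i // i ≠ v}), f M i ⟨w₁, hw⟩ = M i w₁ + M i w₂ :=
    fun M i => by simp [hf]
  have hf₂ : ∀ (M : Matrix I J ℝ) (i : {i // i ≠ v}) (j : {j // j ≠ w₂}), (j : J) ≠ w₁ →
      f M i j = M i j := fun M i j hj => by simp [hf, hj]
  refine nonempty_facesOf_orderIso f (convex_supportPolytope N) ?_ ?_
  · intro x hx y hy hxy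
    have hoff : ∀ i ≠ v, ∀ j, x i j = y i j := by
      intro i hi j
      have h1 : x i w₁ + x i w₂ = y i w₁ + y i w₂ := by
        rw [← hf₁ x ⟨i, hi⟩, ← hf₁ y ⟨i, hi⟩, hxy]
      have h2 : x i w₁ = y i w₁ ∧ x i w₂ = y i w₂ := by
        by_cases h3 : w₁ ∈ N i
        · have h4 : w₂ ∉ N i := fun h => hred i hi ⟨h3, h⟩
          rw [hx.2.1 _ _ h4, hy.2.1 _ _ h4] at h1 ⊢
          exact ⟨by linarith, rfl⟩
        · rw [hx.2.1 _ _ h3, hy.2.1 _ _ h3] at h1 ⊢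
          exact ⟨rfl, by linarith⟩
      by_cases hj₁ : j = w₁
      · exact hj₁ ▸ h2.1
      by_cases hj₂ : j = w₂
      · exact hj₂ ▸ h2.2
      rw [← hf₂ x ⟨i, hi⟩ ⟨j, hj₂⟩ hj₁, ← hf₂ y ⟨i, hi⟩ ⟨j, hj₂⟩ hj₁, hxy]
    ext i j
    by_cases hi : i = v
    · rw [hi, hcol x hx, hcol y hy, Finset.sum_congr rfl fun (i : {i // i ≠ v}) _ => hoff i i.2 j]
    · exact hoff i hi j
  · apply Set.Subset.antisymm
    · rintro _ ⟨M, hM, rfl⟩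
      have hrowM := hrow M hM
      have hcolM := hcol M hM
      obtain ⟨h, h0, hr, hc⟩ := hM
      refine ⟨fun i j => ?_, fun i j hj => ?_, fun i => ?_, fun j => ?_⟩
      · rw [hf]
        exact add_nonneg (h _ _) (by split_ifs; exacts [h _ _, le_rfl])
      · rw [Finset.mem_subtype] at hj
        by_cases hj₁ : (j : J) = w₁
        · obtain rfl : j = ⟨w₁, hw⟩ := Subtype.ext hj₁
          rw [hf₁]
          by_cases h2 : w₂ ∈ N i
          · simp [h2] at hj
          · simp only [h2, if_false] at hj
            rw [h0 _ _ hj, h0 _ _ h2, add_zero]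
        · rw [hf₂ _ _ _ hj₁]
          refine h0 _ _ fun h => hj ?_
          split_ifs <;> simp [h]
      · have h1 := hr i
        rw [Fintype.sum_eq_add_sum_subtype_ne _ w₂] at h1
        simp only [hf, Finset.sum_add_distrib]
        have h2 : ∑ j : {j // j ≠ w₂}, (if (j : J) = w₁ then M i w₂ else 0) = M i w₂ := by
          rw [Fintype.sum_eq_single (⟨w₁, hw⟩ : {j // j ≠ w₂}), if_pos rfl]
          exact fun j hj => if_neg fun h => hj (Subtype.ext h)
        linarith
      · by_cases hj₁ : (j : J) = w₁
        · obtain rfl : j = ⟨w₁, hw⟩ := Subtype.ext hj₁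
          simp only [hf₁, Finset.sum_add_distrib]
          linarith [hcolM w₁, hcolM w₂]
        · have hv0 : M v j = 0 := h0 _ _ (by simp [hv, hj₁, j.2])
          simp only [hf₂ _ _ _ hj₁]
          linarith [hcolM j]
    · rintro X ⟨h, h0, hr, hc⟩
      let Y : {i // i ≠ v} → J → ℝ := fun i j =>
        if hj : j = w₂ then (if w₂ ∈ N i then X i ⟨w₁, hw⟩ else 0)
        else if j = w₁ then (if w₁ ∈ N i then X i ⟨w₁, hw⟩ else 0) else X i ⟨j, hj⟩
      have hYnonneg : ∀ i j, 0 ≤ Y i j := by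
        intro i j
        dsimp only [Y]
        split_ifs <;> first | exact le_rfl | exact h _ _
      have hYsupp : ∀ i : {i // i ≠ v}, ∀ j ∉ N i, Y i j = 0 := by
        intro i j hj
        dsimp only [Y]
        split_ifs with h1 h2 h3 h4
        · exact absurd h2 (h1 ▸ hj)
        · rfl
        · exact absurd h4 (h3 ▸ hj)
        · rfl
        · refine h0 _ _ ?_
          rw [Finset.mem_subtype]
          split_ifs <;> simp [h3, hj]
      have hYw : ∀ i, Y i w₁ + Y i w₂ = X i ⟨w₁, hw⟩ := by
        intro i
        have := hred i i.2
        by_cases h1 : w₁ ∈ N i <;> by_cases h2 : w₂ ∈ N i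
        · exact absurd ⟨h1, h2⟩ this
        · simp [Y, h1, h2, hw]
        · simp [Y, h1, h2, hw]
        · simp only [Y, h1, h2, hw, dif_neg, dif_pos, if_false, if_true, not_false_eq_true, add_zero]
          exact (h0 _ _ (by simp [h1, h2])).symm
      have hYo : ∀ i (j : {j // j ≠ w₂}), (j : J) ≠ w₁ → Y i j = X i j := by
        intro i j hj
        simp [Y, hj, j.2]
      have hYcol : ∀ j, ∑ i, Y i j ≤ 1 := by
        intro j
        by_cases hj₂ : j = w₂
        · rw [← hc ⟨w₁, hw⟩, hj₂]
          refine Finset.sum_le_sum fun i _ => ?_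
          linarith [hYw i, hYnonneg i w₁]
        by_cases hj₁ : j = w₁
        · rw [← hc ⟨w₁, hw⟩, hj₁]
          refine Finset.sum_le_sum fun i _ => ?_
          linarith [hYw i, hYnonneg i w₂]
        · rw [← hc ⟨j, hj₂⟩]
          exact Finset.sum_le_sum fun i _ => (hYo i ⟨j, hj₂⟩ hj₁).le
      have hYcolw : ∑ i, Y i w₁ + ∑ i, Y i w₂ = 1 := by
        rw [← Finset.sum_add_distrib, ← hc ⟨w₁, hw⟩]
        exact Finset.sum_congr rfl fun i _ => hYw i
      let Z : Matrix I J ℝ := fun i j => if hi : i = v then 1 - ∑ i, Y i j else Y ⟨i, hi⟩ j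
      have hZv : ∀ j, Z v j = 1 - ∑ i, Y i j := fun j => by simp [Z]
      have hZo : ∀ (i : {i // i ≠ v}) j, Z i j = Y i j := fun i j => by simp [Z, i.2]
      have hZv0 : ∀ j ∉ N v, Z v j = 0 := by
        intro j hj
        simp only [hv, Finset.mem_insert, Finset.mem_singleton, not_or] at hj
        rw [hZv, Finset.sum_congr rfl fun i _ => hYo i ⟨j, hj.2⟩ hj.1, hc, sub_self]
      refine ⟨Z, ⟨fun i j => ?_, fun i j hj => ?_, fun i => ?_, fun j => ?_⟩, ?_⟩
      · by_cases hi : i = v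
        · rw [hi, hZv]
          linarith [hYcol j]
        · exact hZo ⟨i, hi⟩ j ▸ hYnonneg _ _
      · by_cases hi : i = v
        · subst hi
          exact hZv0 j hj
        · rw [hZo ⟨i, hi⟩]
          exact hYsupp _ _ hj
      · by_cases hi : i = v
        · subst hi
          rw [← Finset.sum_subset (Finset.subset_univ (N i)) fun j _ hj => hZv0 j hj, hv,
            Finset.sum_pair hw, hZv, hZv]
          linarith
        · have hsum := hr ⟨i, hi⟩
          rw [Finset.sum_congr rfl fun j _ => hZo ⟨i, hi⟩ j,
            Fintype.sum_eq_add_sum_subtype_ne _ w₂,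
            Fintype.sum_eq_add_sum_subtype_ne _ (⟨w₁, hw⟩ : {j // j ≠ w₂})]
          rw [Fintype.sum_eq_add_sum_subtype_ne _ (⟨w₁, hw⟩ : {j // j ≠ w₂}),
            ← hYw] at hsum
          rw [Finset.sum_congr rfl fun (j : {j : {j // j ≠ w₂} // j ≠ ⟨w₁, hw⟩}) _ =>
            hYo ⟨i, hi⟩ j fun h => j.2 (Subtype.ext h)]
          linarith
      · rw [Fintype.sum_eq_add_sum_subtype_ne _ v, hZv,
          Finset.sum_congr rfl fun i _ => hZo i j]
        ring
      · ext i j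
        by_cases hj₁ : (j : J) = w₁
        · obtain rfl : j = ⟨w₁, hw⟩ := Subtype.ext hj₁
          rw [hf₁, hZo, hZo, hYw]
        · rw [hf₂ _ _ _ hj₁, hZo, hYo _ _ hj₁]

end SupportPolytope

section TotalSupport

variable {I J : Type*} [Fintype I] [Fintype J] {N : I → Finset J} {M : Matrix I J ℝ}

lemma exists_pos_nonneg_add_mul (hM : M ∈ supportPolytope N) (hpos : ∀ i, ∀ j ∈ N i, 0 < M i j)
    {X : Matrix I J ℝ} (hX : ∀ i, ∀ j ∉ N i, X i j = 0) :
    ∃ ε > 0, ∀ i j, 0 ≤ M i j + ε * X i j := by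
  have h : ∀ᶠ ε in nhdsWithin (0 : ℝ) (Set.Ioi 0), ∀ i j, 0 ≤ M i j + ε * X i j := by
    refine Filter.eventually_all.2 fun i => Filter.eventually_all.2 fun j => ?_
    by_cases hj : j ∈ N i
    · have hcont : Filter.Tendsto (fun ε : ℝ => M i j + ε * X i j) (nhds 0)
          (nhds (M i j + 0 * X i j)) := Continuous.tendsto (by fun_prop) 0
      have hlt : 0 < M i j + 0 * X i j := by simpa using hpos i j hj
      exact nhdsWithin_le_nhds ((hcont.eventually (lt_mem_nhds hlt)).mono fun _ h => h.le)
    · simp [hM.2.1 i j hj, hX i j hj]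
  obtain ⟨ε, hε, hε0⟩ := (h.and self_mem_nhdsWithin).exists
  exact ⟨ε, hε0, hε⟩

/-- A nonempty face of the Birkhoff polytope is determined by its support. -/
lemma exists_eq_supportPolytope {n : Type*} [Fintype n] [DecidableEq n] [Nonempty n]
    {F : Set (Matrix n n ℝ)} (hne : F.Nonempty) (hconv : Convex ℝ F)
    (hext : IsExtreme ℝ (doublyStochastic ℝ n : Set (Matrix n n ℝ)) F) :
    ∃ N : n → Finset n, F = supportPolytope N ∧
      ∃ M ∈ supportPolytope N, ∀ i, ∀ j ∈ N i, 0 < M i j := by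
  classical
  let N : n → Finset n := fun i => Finset.univ.filter fun j => ∃ M ∈ F, M i j ≠ 0
  have hF : ∀ M ∈ F, M ∈ supportPolytope N := by
    intro M hM
    obtain ⟨h, hr, hc⟩ := mem_doublyStochastic_iff_sum.1 (hext.subset hM)
    refine ⟨h, fun i j hj => ?_, hr, hc⟩
    by_contra hne
    exact hj (by simpa [N] using ⟨M, hM, hne⟩)
  have hG : ∀ p : n × n, ∃ G ∈ F, p.2 ∈ N p.1 → G p.1 p.2 ≠ 0 := by
    rintro ⟨i, j⟩
    by_cases hj : j ∈ N i
    · obtain ⟨G, hG, hGj⟩ := (Finset.mem_filter.1 hj).2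
      exact ⟨G, hG, fun _ => hGj⟩
    · exact ⟨hne.some, hne.some_mem, fun h => absurd h hj⟩
  choose G hGF hGne using hG
  let c : ℝ := (Fintype.card (n × n) : ℝ)⁻¹
  have hc : 0 < c := by positivity
  let M : Matrix n n ℝ := ∑ p, c • G p
  have hMF : M ∈ F := by
    refine hconv.sum_mem (fun _ _ => hc.le) ?_ fun p _ => hGF p
    rw [Finset.sum_const, nsmul_eq_mul, Finset.card_univ, mul_inv_cancel₀]
    positivity
  have hpos : ∀ i, ∀ j ∈ N i, 0 < M i j := by
    intro i j hj
    have hMij : M i j = ∑ p, c * G p i j := by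
      simp [M, Matrix.sum_apply]
    rw [hMij]
    refine Finset.sum_pos' (fun p _ => mul_nonneg hc.le ((hF _ (hGF p)).1 i j))
      ⟨(i, j), Finset.mem_univ _, mul_pos hc ?_⟩
    exact lt_of_le_of_ne ((hF _ (hGF _)).1 i j) (hGne (i, j) hj).symm
  refine ⟨N, Set.Subset.antisymm hF fun X hX => ?_, M, hF M hMF, hpos⟩
  obtain ⟨ε, hε, hεn⟩ := exists_pos_nonneg_add_mul (X := M - X) (hF M hMF) hpos fun i j hj => by
    simp [(hF M hMF).2.1 i j hj, hX.2.1 i j hj]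
  have hM := hF M hMF
  have hZ : M + ε • (M - X) ∈ doublyStochastic ℝ n := by
    refine mem_doublyStochastic_iff_sum.2 ⟨hεn, fun i => ?_, fun j => ?_⟩
    · simp [Finset.sum_add_distrib, ← Finset.mul_sum, hM.2.2.1, hX.2.2.1]
    · simp [Finset.sum_add_distrib, ← Finset.mul_sum, hM.2.2.2, hX.2.2.2]
  refine hext.left_mem_of_mem_openSegment ((isExtreme_supportPolytope N).subset hX) hZ hMF
    ⟨ε / (1 + ε), 1 / (1 + ε), by positivity, by positivity, by field_simp; ring, ?_⟩
  have h1 : (1 + ε) ≠ 0 := by positivity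
  ext i j
  simp only [Matrix.add_apply, Matrix.smul_apply, Matrix.sub_apply, smul_eq_mul]
  field_simp
  ring

lemma sum_sum_eq_card (hM : M ∈ supportPolytope N) {S : Finset I} {T : Finset J}
    (hST : ∀ i ∈ S, N i ⊆ T) : ∑ j ∈ T, ∑ i ∈ S, M i j = S.card := by
  obtain ⟨-, h0, hr, -⟩ := hM
  refine Finset.sum_comm.trans ?_
  rw [Finset.card_eq_sum_ones, Nat.cast_sum]
  refine Finset.sum_congr rfl fun i hi => ?_
  rw [Nat.cast_one, ← hr i]
  exact Finset.sum_subset (Finset.subset_univ _) fun j _ hj => h0 i j (mt (@hST i hi j) hj)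

lemma card_le_card_of_subset (hM : M ∈ supportPolytope N) {S : Finset I} {T : Finset J}
    (hST : ∀ i ∈ S, N i ⊆ T) : S.card ≤ T.card := by
  have h1 := sum_sum_eq_card hM hST
  obtain ⟨h, -, -, hc⟩ := hM
  have h2 : ∑ j ∈ T, ∑ i ∈ S, M i j ≤ T.card := by
    rw [Finset.card_eq_sum_ones, Nat.cast_sum]
    refine Finset.sum_le_sum fun j _ => ?_
    rw [Nat.cast_one, ← hc j]
    exact Finset.sum_le_sum_of_subset_of_nonneg (Finset.subset_univ _) fun i _ _ => h i j
  exact_mod_cast h1 ▸ h2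

lemma notMem_of_card_le_card (hM : M ∈ supportPolytope N) (hpos : ∀ i, ∀ j ∈ N i, 0 < M i j)
    {S : Finset I} {T : Finset J} (hST : ∀ i ∈ S, N i ⊆ T) (hcard : T.card ≤ S.card)
    {i : I} (hi : i ∉ S) {j : J} (hj : j ∈ T) : j ∉ N i := by
  classical
  intro hij
  have h1 := sum_sum_eq_card hM hST
  obtain ⟨h, -, -, hc⟩ := hM
  have h2 : ∑ j ∈ T, ∑ i ∈ S, M i j < T.card := by
    rw [Finset.card_eq_sum_ones, Nat.cast_sum]
    refine Finset.sum_lt_sum (fun j _ => ?_) ⟨j, hj, ?_⟩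
    · rw [Nat.cast_one, ← hc j]
      exact Finset.sum_le_sum_of_subset_of_nonneg (Finset.subset_univ _) fun i _ _ => h i j
    · rw [Nat.cast_one, ← hc j]
      exact Finset.sum_lt_sum_of_subset (Finset.subset_univ _) (Finset.mem_univ i) hi
        (hpos i j hij) fun i _ _ => h i j
  rw [h1] at h2
  exact absurd hcard (not_le.2 (by exact_mod_cast h2))

/-- Lower bound for the dimension of a support polytope in terms of the number of nodes, edges
and blocks of the underlying bipartite graph. -/
lemma sum_card_add_card_le_finrank {κ : Type*} [Fintype κ]
    (hM : M ∈ supportPolytope N) (hpos : ∀ i, ∀ j ∈ N i, 0 < M i j) (f : I → κ) (g : J → κ)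
    (hf : Function.Surjective f) (hfg : ∀ i, ∀ j ∈ N i, f i = g j) :
    ∑ i, (N i).card + Fintype.card κ ≤
      Fintype.card I + Fintype.card J +
        Module.finrank ℝ (vectorSpan ℝ (supportPolytope N)) := by
  classical
  let Ed := Σ i, {j // j ∈ N i}
  let ι : (Ed → ℝ) →ₗ[ℝ] Matrix I J ℝ :=
    { toFun := fun x i j => if h : j ∈ N i then x ⟨i, j, h⟩ else 0
      map_add' := fun x y => by
        ext i j
        change (if h : j ∈ N i then x ⟨i, j, h⟩ + y ⟨i, j, h⟩ else 0) =
          (if h : j ∈ N i then x ⟨i, j, h⟩ else 0) + (if h : j ∈ N i then y ⟨i, j, h⟩ else 0)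
        split_ifs <;> simp
      map_smul' := fun c x => by
        ext i j
        change (if h : j ∈ N i then c * x ⟨i, j, h⟩ else 0) =
          c * (if h : j ∈ N i then x ⟨i, j, h⟩ else 0)
        split_ifs <;> simp }
  have hι : ∀ x i j, ι x i j = if h : j ∈ N i then x ⟨i, j, h⟩ else 0 := fun _ _ _ => rfl
  have hιinj : Function.Injective ι := by
    intro x y hxy
    funext ⟨i, j, hj⟩
    have h := congrFun (congrFun hxy i) j
    rwa [hι, hι, dif_pos hj, dif_pos hj] at h
  let T₀ : Matrix I J ℝ →ₗ[ℝ] (I → ℝ) × (J → ℝ) :=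
    { toFun := fun X => (fun i => ∑ j, X i j, fun j => ∑ i, X i j)
      map_add' := fun X Y => by ext <;> simp [Finset.sum_add_distrib]
      map_smul' := fun c X => by ext <;> simp [Finset.mul_sum] }
  let T := T₀ ∘ₗ ι
  let Q : (I → ℝ) × (J → ℝ) →ₗ[ℝ] (κ → ℝ) :=
    { toFun := fun rs k => (∑ i with f i = k, rs.1 i) - ∑ j with g j = k, rs.2 j
      map_add' := fun x y => by
        ext k
        simp [Finset.sum_add_distrib]
        ring
      map_smul' := fun c x => by
        ext k
        simp [← Finset.mul_sum]
        ring }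
  have hQ : Function.Surjective Q := by
    intro y
    obtain ⟨s, hs⟩ := hf.hasRightInverse
    refine ⟨(fun i => if i = s (f i) then y (f i) else 0, 0), ?_⟩
    funext k
    change (∑ i with f i = k, if i = s (f i) then y (f i) else 0) - ∑ j with g j = k, (0 : ℝ) = y k
    rw [Finset.sum_const_zero, sub_zero, Finset.sum_eq_single (s k)]
    · simp [hs k]
    · intro i hi hik
      rw [if_neg]
      rwa [(Finset.mem_filter.1 hi).2]
    · simp [hs k]
  have hTQ : LinearMap.range T ≤ LinearMap.ker Q := by
    rintro _ ⟨x, rfl⟩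
    rw [LinearMap.mem_ker]
    funext k
    change (∑ i with f i = k, ∑ j, ι x i j) - ∑ j with g j = k, ∑ i, ι x i j = 0
    rw [sub_eq_zero, Finset.sum_filter, Finset.sum_filter]
    have : ∀ i j, (if f i = k then ι x i j else 0) = if g j = k then ι x i j else 0 := by
      intro i j
      by_cases hj : j ∈ N i
      · rw [hfg i j hj]
      · rw [hι, dif_neg hj, ite_self, ite_self]
    calc ∑ i, (if f i = k then ∑ j, ι x i j else 0)
        = ∑ i, ∑ j, (if f i = k then ι x i j else 0) :=
          Finset.sum_congr rfl fun i _ => by split_ifs <;> simp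
      _ = ∑ j, ∑ i, (if f i = k then ι x i j else 0) := Finset.sum_comm
      _ = ∑ j, ∑ i, (if g j = k then ι x i j else 0) :=
          Finset.sum_congr rfl fun j _ => Finset.sum_congr rfl fun i _ => this i j
      _ = ∑ j, (if g j = k then ∑ i, ι x i j else 0) :=
          Finset.sum_congr rfl fun j _ => by split_ifs <;> simp
  have hker : (LinearMap.ker T).map ι ≤ vectorSpan ℝ (supportPolytope N) := by
    rintro _ ⟨x, hx, rfl⟩
    have hx' : T₀ (ι x) = 0 := hx
    have hrow : ∀ i, ∑ j, ι x i j = 0 := fun i => congrFun (congrArg Prod.fst hx') i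
    have hcol : ∀ j, ∑ i, ι x i j = 0 := fun j => congrFun (congrArg Prod.snd hx') j
    have hsupp : ∀ i, ∀ j ∉ N i, ι x i j = 0 := fun i j hj => by rw [hι, dif_neg hj]
    obtain ⟨ε, hε, hεn⟩ := exists_pos_nonneg_add_mul hM hpos hsupp
    have hmem : M + ε • ι x ∈ supportPolytope N := by
      refine ⟨hεn, fun i j hj => ?_, fun i => ?_, fun j => ?_⟩
      · simp [hM.2.1 i j hj, hsupp i j hj]
      · simp [Finset.sum_add_distrib, ← Finset.mul_sum, hM.2.2.1, hrow]
      · simp [Finset.sum_add_distrib, ← Finset.mul_sum, hM.2.2.2, hcol]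
    have h := vsub_mem_vectorSpan ℝ hmem hM
    rw [vsub_eq_sub, add_sub_cancel_left] at h
    simpa [smul_smul, hε.ne'] using Submodule.smul_mem _ ε⁻¹ h
  have h1 : Module.finrank ℝ (LinearMap.range T) + Module.finrank ℝ (LinearMap.ker T) =
      ∑ i, (N i).card := by
    rw [LinearMap.finrank_range_add_finrank_ker, Module.finrank_fintype_fun_eq_card]
    simp [Ed]
  have h2 : Fintype.card κ + Module.finrank ℝ (LinearMap.ker Q) =
      Fintype.card I + Fintype.card J := by
    have h := LinearMap.finrank_range_add_finrank_ker Q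
    rw [LinearMap.range_eq_top.2 hQ, finrank_top] at h
    simpa using h
  have h3 := Submodule.finrank_mono hTQ
  have h4 := Submodule.finrank_mono hker
  rw [(Submodule.equivMapOfInjective ι hιinj _).symm.finrank_eq] at h4
  omega

end TotalSupport

section Blocks

variable {I J : Type*} [Fintype I] [Fintype J] {N : I → Finset J} {M : Matrix I J ℝ}

/-- The connected components of the bipartite graph of a support polytope. -/
lemma exists_components (hM : M ∈ supportPolytope N) :
    ∃ (κ : Type) (_ : Fintype κ) (_ : DecidableEq κ) (f : I → κ) (g : J → κ),
      Function.Surjective f ∧ (∀ i, ∀ j ∈ N i, f i = g j) ∧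
      ∀ S : Finset I, (∀ i ∈ S, ∀ i' ∉ S, Disjoint (N i) (N i')) →
        ∀ i ∈ S, ∀ i', f i' = f i → i' ∈ S := by
  classical
  let s : Setoid I :=
    { r := fun i i' => ∀ S : Finset I, (∀ i ∈ S, ∀ i' ∉ S, Disjoint (N i) (N i')) →
        (i ∈ S ↔ i' ∈ S)
      iseqv := ⟨fun _ _ _ => Iff.rfl, fun h S hS => (h S hS).symm,
        fun h h' S hS => (h S hS).trans (h' S hS)⟩ }
  have hshare : ∀ i i' j, j ∈ N i → j ∈ N i' → s i i' := by
    intro i i' j hi hi' S hS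
    constructor <;> intro h <;> by_contra h'
    · exact Finset.disjoint_left.1 (hS i h i' h') hi hi'
    · exact Finset.disjoint_left.1 (hS i' h i h') hi' hi
  have hcol : ∀ j, ∃ i, j ∈ N i := by
    intro j
    by_contra! h
    have h1 := hM.2.2.2 j
    rw [Finset.sum_eq_zero fun i _ => hM.2.1 i j (h i)] at h1
    exact zero_ne_one h1
  choose c hc using hcol
  let e : Quotient s ≃ Fin (Fintype.card (Quotient s)) := Fintype.equivFin _
  refine ⟨Fin (Fintype.card (Quotient s)), inferInstance, inferInstance,
    fun i => e (Quotient.mk s i), fun j => e (Quotient.mk s (c j)),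
    e.surjective.comp Quotient.mk_surjective, ?_, ?_⟩
  · exact fun i j hj => congrArg e (Quotient.sound (hshare i (c j) j hj (hc j)))
  · intro S hS i hi i' h
    exact (Quotient.exact (e.injective h) S hS).2 hi

/-- In an irreducible graph of minimum degree two, a connected component on `b` upper nodes has at
least `5 * b / 2` edges, with exactly two kinds of exceptions. -/
lemma component_edge_bound (hM : M ∈ supportPolytope N) (hpos : ∀ i, ∀ j ∈ N i, 0 < M i j)
    (hdeg : ∀ i, 2 ≤ (N i).card)
    (hirr : ∀ v w₁ w₂, w₁ ≠ w₂ → {w₁, w₂} = (N v : Set J) → ∃ u ≠ v, w₁ ∈ N u ∧ w₂ ∈ N u)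
    {B : Finset I} (hclosed : ∀ i ∈ B, ∀ i' ∉ B, Disjoint (N i) (N i'))
    (hconn : ∀ S ⊆ B, S.Nonempty → (∀ i ∈ S, ∀ i' ∉ S, Disjoint (N i) (N i')) → S = B) :
    5 * B.card ≤ 2 * ∑ i ∈ B, (N i).card ∨
      (B.card = 2 ∧ ∑ i ∈ B, (N i).card = 4) ∨ (B.card = 3 ∧ ∑ i ∈ B, (N i).card = 7) := by
  classical
  have htight : ∀ S ⊆ B, S.Nonempty → ∀ T : Finset J, (∀ i ∈ S, N i ⊆ T) → T.card ≤ S.card →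
      S = B := by
    intro S hS hSne T hST hcard
    refine hconn S hS hSne fun i hi i' hi' => Finset.disjoint_left.2 fun j hj => ?_
    exact notMem_of_card_le_card hM hpos hST hcard hi' (hST i hi hj)
  have hpartner : ∀ v ∈ B, (N v).card = 2 → ∃ u ∈ B, u ≠ v ∧ N v ⊆ N u := by
    intro v hv hv2
    obtain ⟨w₁, w₂, hw, hN⟩ := Finset.card_eq_two.1 hv2
    obtain ⟨u, huv, h₁, h₂⟩ := hirr v w₁ w₂ hw (by simp [hN])
    refine ⟨u, ?_, huv, ?_⟩
    · by_contra hu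
      exact Finset.disjoint_left.1 (hclosed v hv u hu) (by simp [hN]) h₁
    · rw [hN]
      simp [Finset.insert_subset_iff, h₁, h₂]
  by_cases hK : ∃ u ∈ B, ∃ v ∈ B, u ≠ v ∧ N u = N v ∧ (N v).card = 2
  · obtain ⟨u, hu, v, hv, huv, hN, hv2⟩ := hK
    have h := htight {u, v} (by simp [Finset.insert_subset_iff, hu, hv]) (by simp) (N v)
      (by simp [hN]) (by rw [hv2, Finset.card_pair huv])
    rw [← h, Finset.card_pair huv, Finset.sum_pair huv, hN, hv2]
    simp
  have hpartner' : ∀ v, ∃ u, v ∈ B → (N v).card = 2 → u ∈ B ∧ 3 ≤ (N u).card ∧ N v ⊆ N u := by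
    intro v
    by_cases h : v ∈ B ∧ (N v).card = 2
    · obtain ⟨u, hu, huv, hN⟩ := hpartner v h.1 h.2
      refine ⟨u, fun _ _ => ⟨hu, ?_, hN⟩⟩
      by_contra h3
      have h2 := hdeg u
      refine hK ⟨u, hu, v, h.1, huv, (Finset.eq_of_subset_of_card_le hN ?_).symm, h.2⟩
      omega
    · exact ⟨v, fun h₁ h₂ => absurd ⟨h₁, h₂⟩ h⟩
  choose p hp using hpartner'
  let A := B.filter fun v => (N v).card = 2
  let H := B.filter fun v => ¬(N v).card = 2
  have hAp : ∀ v ∈ A, p v ∈ H ∧ N v ⊆ N (p v) := by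
    intro v hv
    obtain ⟨h1, h2⟩ := Finset.mem_filter.1 hv
    obtain ⟨h3, h4, h5⟩ := hp v h1 h2
    exact ⟨Finset.mem_filter.2 ⟨h3, by omega⟩, h5⟩
  have hcardB : A.card + H.card = B.card := Finset.card_filter_add_card_filter_not _
  have hsumB : ∑ i ∈ A, (N i).card + ∑ i ∈ H, (N i).card = ∑ i ∈ B, (N i).card :=
    Finset.sum_filter_add_sum_filter_not _ _ _
  have hsumA : ∑ i ∈ A, (N i).card = 2 * A.card := by
    rw [Finset.sum_congr rfl fun i hi => (Finset.mem_filter.1 hi).2, Finset.sum_const, smul_eq_mul,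
      mul_comm]
  have hH3 : ∀ u ∈ H, 3 ≤ (N u).card := by
    intro u hu
    have h1 := (Finset.mem_filter.1 hu).2
    have h2 := hdeg u
    omega
  have hnotA : ∀ u ∈ H, u ∉ A := fun u hu h =>
    (Finset.mem_filter.1 hu).2 (Finset.mem_filter.1 h).2
  have hfib : A.card = ∑ u ∈ H, (A.filter fun v => p v = u).card :=
    Finset.card_eq_sum_card_fiberwise fun v hv => (hAp v hv).1
  have hstar : ∀ u ∈ H, ∀ i ∈ insert u (A.filter fun v => p v = u), N i ⊆ N u := by
    intro u hu i hi
    rcases Finset.mem_insert.1 hi with rfl | hi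
    · exact subset_rfl
    · obtain ⟨h1, rfl⟩ := Finset.mem_filter.1 hi
      exact (hAp i h1).2
  have hcard : ∀ u ∈ H, (insert u (A.filter fun v => p v = u)).card =
      (A.filter fun v => p v = u).card + 1 := fun u hu =>
    Finset.card_insert_of_notMem fun h => hnotA u hu (Finset.mem_filter.1 h).1
  by_cases hfull : ∃ u ∈ H, (N u).card ≤ (A.filter fun v => p v = u).card + 1
  · obtain ⟨u, hu, hle⟩ := hfull
    have hsub : insert u (A.filter fun v => p v = u) ⊆ B := by
      refine Finset.insert_subset (Finset.filter_subset _ _ hu) ?_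
      exact (Finset.filter_subset _ _).trans (Finset.filter_subset _ _)
    have hBeq := htight _ hsub (Finset.insert_nonempty _ _) (N u) (hstar u hu)
      ((hcard u hu).symm ▸ hle)
    have hHu : H = {u} := by
      refine Finset.Subset.antisymm (fun v hv => ?_) (by simpa using hu)
      have h1 : v ∈ B := Finset.filter_subset _ _ hv
      rw [← hBeq] at h1
      rcases Finset.mem_insert.1 h1 with h1 | h1
      · simp [h1]
      · exact absurd (Finset.mem_filter.1 h1).1 (hnotA v hv)
    have h2 := card_le_card_of_subset hM (hstar u hu)
    have h3 := hH3 u hu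
    have h4 := hcard u hu
    rw [hHu, Finset.sum_singleton] at hfib hsumB
    rw [hHu, Finset.card_singleton] at hcardB
    omega
  · push Not at hfull
    have h1 : ∑ u ∈ H, ((A.filter fun v => p v = u).card + 2) ≤ ∑ u ∈ H, (N u).card :=
      Finset.sum_le_sum fun u hu => hfull u hu
    have h2 : ∑ u ∈ H, 3 ≤ ∑ u ∈ H, (N u).card := Finset.sum_le_sum hH3
    rw [Finset.sum_add_distrib, ← hfib] at h1
    simp only [Finset.sum_const, smul_eq_mul] at h1 h2
    left
    omega

/-- A column cannot meet only one row when all rows have degree at least two. -/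
lemma exists_ne_mem (hM : M ∈ supportPolytope N) (hpos : ∀ i, ∀ j ∈ N i, 0 < M i j)
    (hcard : Fintype.card I = Fintype.card J) (hdeg : ∀ i, 2 ≤ (N i).card) (i : I) (j : J) :
    ∃ i' ≠ i, j ∈ N i' := by
  classical
  by_contra! h
  have hsub : N i ⊆ {j} := by
    intro j' hj'
    by_contra hne
    refine notMem_of_card_le_card hM hpos (S := {i}ᶜ) (T := {j}ᶜ) ?_ ?_ (i := i) (by simp)
      (j := j') (by simpa using hne) hj'
    · intro i' hi' j'' hj''
      simp only [Finset.mem_compl, Finset.mem_singleton] at hi' ⊢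
      rintro rfl
      exact h i' hi' hj''
    · simp [Finset.card_compl, hcard]
  have h1 := Finset.card_le_card hsub
  have h2 := hdeg i
  rw [Finset.card_singleton] at h1
  omega

/-- The component structure forced by a support polytope of dimension `d` on `2 * d - 1` rows:
one component on three upper nodes with seven edges, all others on two upper nodes. -/
lemma exists_component_structure (hM : M ∈ supportPolytope N)
    (hpos : ∀ i, ∀ j ∈ N i, 0 < M i j) (hcard : Fintype.card I = Fintype.card J)
    (hdeg : ∀ i, 2 ≤ (N i).card)
    (hirr : ∀ v w₁ w₂, w₁ ≠ w₂ → {w₁, w₂} = (N v : Set J) → ∃ u ≠ v, w₁ ∈ N u ∧ w₂ ∈ N u)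
    (hdim : Fintype.card I + 1 = 2 * Module.finrank ℝ (vectorSpan ℝ (supportPolytope N))) :
    ∃ (κ : Type) (_ : Fintype κ) (_ : DecidableEq κ) (f : I → κ) (g : J → κ) (k₀ : κ),
      (∀ i, ∀ j ∈ N i, f i = g j) ∧
      (∀ k, (Finset.univ.filter fun i => f i = k).card =
        (Finset.univ.filter fun j => g j = k).card) ∧
      (∀ k ≠ k₀, (Finset.univ.filter fun i => f i = k).card = 2) ∧
      (Finset.univ.filter fun i => f i = k₀).card = 3 ∧
      ∑ i with f i = k₀, (N i).card = 7 := by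
  classical
  obtain ⟨κ, _, _, f, g, hf, hfg, hconn⟩ := exists_components hM
  have hle : ∀ k, (Finset.univ.filter fun i => f i = k).card ≤
      (Finset.univ.filter fun j => g j = k).card := by
    refine fun k => card_le_card_of_subset hM fun i hi j hj => ?_
    rw [Finset.mem_filter] at hi ⊢
    exact ⟨Finset.mem_univ _, hfg i j hj ▸ hi.2⟩
  have hsumf : ∑ k, (Finset.univ.filter fun i => f i = k).card = Fintype.card I :=
    (Finset.card_eq_sum_card_fiberwise fun _ _ => Finset.mem_coe.2 (Finset.mem_univ _)).symm
  have hsumg : ∑ k, (Finset.univ.filter fun j => g j = k).card = Fintype.card J :=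
    (Finset.card_eq_sum_card_fiberwise fun _ _ => Finset.mem_coe.2 (Finset.mem_univ _)).symm
  have hfibeq : ∀ k, (Finset.univ.filter fun i => f i = k).card =
      (Finset.univ.filter fun j => g j = k).card := by
    have h := (Finset.sum_eq_sum_iff_of_le fun k _ => hle k).1
      (hsumf.trans (hcard.trans hsumg.symm))
    exact fun k => h k (Finset.mem_univ _)
  have hbound := fun k => component_edge_bound hM hpos hdeg hirr
    (B := Finset.univ.filter fun i => f i = k)
    (by
      intro i hi i' hi'
      rw [Finset.mem_filter] at hi hi'
      refine Finset.disjoint_left.2 fun j hj hj' => hi' ⟨Finset.mem_univ _, ?_⟩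
      rw [hfg i' j hj', ← hfg i j hj, hi.2])
    (by
      intro S hS hne hdis
      refine Finset.Subset.antisymm hS fun i' hi' => ?_
      obtain ⟨i, hi⟩ := hne
      have h1 := (Finset.mem_filter.1 (hS hi)).2
      have h2 := (Finset.mem_filter.1 hi').2
      exact hconn S hdis i hi i' (h2.trans h1.symm))
  have hedges : ∑ k, ∑ i with f i = k, (N i).card = ∑ i, (N i).card :=
    Finset.sum_fiberwise _ _ _
  have hdim' := sum_card_add_card_le_finrank hM hpos f g hf hfg
  let n : κ → ℕ := fun k => (Finset.univ.filter fun i => f i = k).card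
  let e : κ → ℕ := fun k => ∑ i with f i = k, (N i).card
  have hb : ∀ k, 5 * n k ≤ 2 * e k ∨ (n k = 2 ∧ e k = 4) ∨ (n k = 3 ∧ e k = 7) := hbound
  have htotal : ∑ k, (2 * e k + 2) ≤ ∑ k, 5 * n k + 1 := by
    have h1 : ∑ k, n k = Fintype.card I := hsumf
    have h2 : ∑ k, e k = ∑ i, (N i).card := hedges
    rw [Finset.sum_add_distrib, ← Finset.mul_sum, ← Finset.mul_sum, h1, h2, Finset.sum_const,
      Finset.card_univ, smul_eq_mul]
    omega
  have hmin : ∀ k, 5 * n k ≤ 2 * e k + 2 := fun k => by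
    have := hb k
    omega
  obtain ⟨k₀, hk₀⟩ : ∃ k, ¬(n k = 2 ∧ e k = 4) := by
    by_contra! h
    have h1 : ∑ k, n k = Fintype.card I := hsumf
    rw [Finset.sum_congr rfl fun k _ => (h k).1, Finset.sum_const, smul_eq_mul] at h1
    omega
  rw [← Finset.add_sum_erase _ _ (Finset.mem_univ k₀),
    ← Finset.add_sum_erase _ _ (Finset.mem_univ k₀)] at htotal
  have h0 := hb k₀
  have hrest : ∀ k ≠ k₀, n k = 2 := by
    intro k hk
    have hmem : k ∈ Finset.univ.erase k₀ := by simp [hk]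
    rw [← Finset.add_sum_erase _ _ hmem, ← Finset.add_sum_erase _ _ hmem] at htotal
    have h1 := Finset.sum_le_sum fun k' (_ : k' ∈ (Finset.univ.erase k₀).erase k) => hmin k'
    have h2 := hb k
    omega
  have h1 := Finset.sum_le_sum fun k' (_ : k' ∈ Finset.univ.erase k₀) => hmin k'
  have hk₀' : n k₀ = 3 ∧ e k₀ = 7 := by omega
  exact ⟨κ, inferInstance, inferInstance, f, g, k₀, hfg, hfibeq, hrest, hk₀'⟩

end Blocks

section CubeTriangle

/-- The disjoint union of complete bipartite graphs `K₂,₂`, one for each element of `κ`, and of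
`K₃,₃` with a matching of size two deleted. -/
def CubeTriangleRel (κ : Type*) : (κ × Fin 2) ⊕ Fin 3 → (κ × Fin 2) ⊕ Fin 3 → Prop
  | .inl p, .inl q => p.1 = q.1
  | .inr a, .inr b => a = b → a = 2
  | .inl _, .inr _ => False
  | .inr _, .inl _ => False

open Classical in
/-- The neighbourhoods in the graph `CubeTriangleRel κ`. -/
noncomputable def cubeTriangleSupport (κ : Type*) [Fintype κ] (i : (κ × Fin 2) ⊕ Fin 3) :
    Finset ((κ × Fin 2) ⊕ Fin 3) :=
  Finset.univ.filter fun j => CubeTriangleRel κ i j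

variable {κ : Type*} [Fintype κ]

lemma mem_cubeTriangleSupport {i j : (κ × Fin 2) ⊕ Fin 3} :
    j ∈ cubeTriangleSupport κ i ↔ CubeTriangleRel κ i j := by
  simp [cubeTriangleSupport]

/-- A block sum over the square blocks of the index set reduces to the block of `k`. -/
lemma sum_square_block (k : κ) (φ : (κ × Fin 2) ⊕ Fin 3 → ℝ)
    (h₁ : ∀ k' ≠ k, ∀ b, φ (.inl (k', b)) = 0) (h₂ : ∀ a, φ (.inr a) = 0) :
    ∑ j, φ j = φ (.inl (k, 0)) + φ (.inl (k, 1)) := by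
  rw [Fintype.sum_sum_type, Finset.sum_eq_zero fun a _ => h₂ a, add_zero, Fintype.sum_prod_type,
    Fintype.sum_eq_single k fun k' hk' => Finset.sum_eq_zero fun b _ => h₁ k' hk' b,
    Fin.sum_univ_two]

lemma sum_triangle_block (φ : (κ × Fin 2) ⊕ Fin 3 → ℝ) (h : ∀ p, φ (.inl p) = 0) :
    ∑ j, φ j = φ (.inr 0) + φ (.inr 1) + φ (.inr 2) := by
  rw [Fintype.sum_sum_type, Finset.sum_eq_zero fun a _ => h a, zero_add, Fin.sum_univ_three]

/-- The matrix with prescribed coordinates `t` in the square blocks and `x` in the triangle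
block. -/
def cubeTriangleMatrix [DecidableEq κ] (t : κ → ℝ) (x : Fin 3 → ℝ) :
    (κ × Fin 2) ⊕ Fin 3 → (κ × Fin 2) ⊕ Fin 3 → ℝ
  | .inl p, .inl q => if p.1 = q.1 then if p.2 = q.2 then t p.1 else 1 - t p.1 else 0
  | .inr a, .inr b => ![![0, 1 - x 0, x 0], ![1 - x 1, 0, x 1], ![x 1, x 0, x 2]] a b
  | .inl _, .inr _ => 0
  | .inr _, .inl _ => 0

lemma cubeTriangleMatrix_mem [DecidableEq κ] {t : κ → ℝ} {x : Fin 3 → ℝ}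
    (ht : t ∈ Set.Icc (0 : κ → ℝ) 1) (hx : x ∈ stdSimplex ℝ (Fin 3)) :
    cubeTriangleMatrix t x ∈ supportPolytope (cubeTriangleSupport κ) := by
  obtain ⟨hx0, hx1⟩ := hx
  rw [Fin.sum_univ_three] at hx1
  have h0 := hx0 0
  have h1 := hx0 1
  have h2 := hx0 2
  refine ⟨?_, ?_, ?_, ?_⟩
  · rintro (⟨k, a⟩ | a) (⟨k', b⟩ | b)
    · have h3 : 0 ≤ t k := ht.1 k
      have h4 : t k ≤ 1 := ht.2 k
      dsimp only [cubeTriangleMatrix]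
      split_ifs <;> linarith
    · exact le_rfl
    · exact le_rfl
    · fin_cases a <;> fin_cases b <;> simp [cubeTriangleMatrix, h0, h1, h2] <;> linarith
  · rintro (⟨k, a⟩ | a) (⟨k', b⟩ | b) h <;> rw [mem_cubeTriangleSupport] at h
    · exact if_neg h
    · rfl
    · rfl
    · revert h
      fin_cases a <;> fin_cases b <;> simp [cubeTriangleMatrix, CubeTriangleRel]
  · rintro (⟨k, a⟩ | a)
    · refine (sum_square_block k _ (fun k' hk' b => if_neg hk'.symm) fun _ => rfl).trans ?_
      fin_cases a <;> simp [cubeTriangleMatrix]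
    · refine (sum_triangle_block _ fun _ => rfl).trans ?_
      fin_cases a <;> simp [cubeTriangleMatrix] <;> linarith
  · rintro (⟨k, b⟩ | b)
    · refine (sum_square_block k _ (fun k' hk' a => if_neg hk') fun _ => rfl).trans ?_
      fin_cases b <;> simp [cubeTriangleMatrix]
    · refine (sum_triangle_block _ fun _ => rfl).trans ?_
      fin_cases b <;> simp [cubeTriangleMatrix] <;> linarith

lemma eq_cubeTriangleMatrix [DecidableEq κ]
    {M : Matrix ((κ × Fin 2) ⊕ Fin 3) ((κ × Fin 2) ⊕ Fin 3) ℝ}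
    (hM : M ∈ supportPolytope (cubeTriangleSupport κ)) :
    M = cubeTriangleMatrix (fun k => M (.inl (k, 0)) (.inl (k, 0)))
      (fun a => M (.inr a) (.inr 2)) := by
  obtain ⟨-, h0, hr, hc⟩ := hM
  have h0' : ∀ i j, ¬CubeTriangleRel κ i j → M i j = 0 := fun i j h =>
    h0 i j (mt mem_cubeTriangleSupport.1 h)
  have hsqr : ∀ k a, M (.inl (k, a)) (.inl (k, 0)) + M (.inl (k, a)) (.inl (k, 1)) = 1 := by
    intro k a
    rw [← hr (.inl (k, a))]
    exact (sum_square_block k _ (fun k' hk' b => h0' (.inl (k, a)) (.inl (k', b)) hk'.symm) fun b => h0' _ _ id).symm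
  have hsqc : ∀ k b, M (.inl (k, 0)) (.inl (k, b)) + M (.inl (k, 1)) (.inl (k, b)) = 1 := by
    intro k b
    rw [← hc (.inl (k, b))]
    exact (sum_square_block k (fun i => M i (.inl (k, b))) (fun k' hk' b' => h0' (.inl (k', b')) (.inl (k, b)) hk')
      fun a => h0' _ _ id).symm
  have htrr : ∀ a, M (.inr a) (.inr 0) + M (.inr a) (.inr 1) + M (.inr a) (.inr 2) = 1 := by
    intro a
    rw [← hr (.inr a)]
    exact (sum_triangle_block _ fun p => h0' _ _ id).symm
  have htrc : ∀ b, M (.inr 0) (.inr b) + M (.inr 1) (.inr b) + M (.inr 2) (.inr b) = 1 := by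
    intro b
    rw [← hc (.inr b)]
    exact (sum_triangle_block (fun i => M i (.inr b)) fun p => h0' _ _ id).symm
  have h00 : M (.inr 0) (.inr 0) = 0 := h0' _ _ (by simp [CubeTriangleRel])
  have h11 : M (.inr 1) (.inr 1) = 0 := h0' _ _ (by simp [CubeTriangleRel])
  ext i j
  rcases i with ⟨k, a⟩ | a <;> rcases j with ⟨k', b⟩ | b
  · by_cases hk : k = k'
    · subst hk
      have h1 := hsqr k 0
      have h2 := hsqc k 0
      have h3 := hsqc k 1
      fin_cases a <;> fin_cases b <;> simp [cubeTriangleMatrix] <;> linarith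
    · exact (h0' (.inl (k, a)) (.inl (k', b)) hk).trans (if_neg hk).symm
  · exact h0' _ _ id
  · exact h0' _ _ id
  · have h1 := htrr 0
    have h2 := htrr 1
    have h3 := htrc 0
    have h4 := htrc 1
    fin_cases a <;> fin_cases b <;> simp [cubeTriangleMatrix] <;> linarith

lemma nonempty_facesOf_orderIso_cube_prod_triangle :
    Nonempty (facesOf (supportPolytope (cubeTriangleSupport κ)) ≃o
      facesOf (Set.Icc (0 : κ → ℝ) 1 ×ˢ stdSimplex ℝ (Fin 3))) := by
  classical
  refine nonempty_facesOf_orderIso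
    { toFun := fun M => (fun k => M (.inl (k, 0)) (.inl (k, 0)), fun a => M (.inr a) (.inr 2))
      map_add' := fun _ _ => rfl
      map_smul' := fun _ _ => rfl } (convex_supportPolytope _) ?_ ?_
  · intro x hx y hy hxy
    rw [eq_cubeTriangleMatrix hx, eq_cubeTriangleMatrix hy]
    exact congrArg₂ cubeTriangleMatrix (congrArg Prod.fst hxy) (congrArg Prod.snd hxy)
  · apply Set.Subset.antisymm
    · rintro _ ⟨M, ⟨h, h0, hr, hc⟩, rfl⟩
      refine ⟨⟨fun k => h _ _, fun k => ?_⟩, fun a => h _ _, ?_⟩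
      · rw [Pi.one_apply, ← hr (.inl (k, 0))]
        exact Finset.single_le_sum (fun j _ => h (.inl (k, 0)) j)
          (Finset.mem_univ (Sum.inl (k, (0 : Fin 2))))
      · rw [← hc (.inr 2), Fin.sum_univ_three]
        exact (sum_triangle_block (fun i => M i (.inr 2)) fun p =>
          h0 _ _ (mt mem_cubeTriangleSupport.1 id)).symm
    · rintro ⟨t, x⟩ ⟨ht, hx⟩
      refine ⟨cubeTriangleMatrix t x, cubeTriangleMatrix_mem ht hx, ?_⟩
      refine Prod.ext (funext fun k => ?_) (funext fun a => ?_)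
      · change cubeTriangleMatrix t x (.inl (k, 0)) (.inl (k, 0)) = t k
        simp [cubeTriangleMatrix]
      · change cubeTriangleMatrix t x (.inr a) (.inr 2) = x a
        fin_cases a <;> simp [cubeTriangleMatrix]

/-- A `3 × 3` pattern with seven entries, at least two in each row and column, is that of the
triangle after reordering rows and columns. -/
lemma exists_triangle_labelling {I J : Type*} {N : I → Finset J} {B : Finset I} {C : Finset J}
    (hB : B.card = 3) (hC : C.card = 3)
    (hN : ∀ i ∈ B, N i ⊆ C) (hdeg : ∀ i, 2 ≤ (N i).card) (hsum : ∑ i ∈ B, (N i).card = 7)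
    (hcol : ∀ i, ∀ j ∈ C, ∃ i' ∈ B, i' ≠ i ∧ j ∈ N i') :
    ∃ (r : Fin 3 → I) (s : Fin 3 → J), Function.Injective r ∧ Function.Injective s ∧
      (∀ a, r a ∈ B) ∧ (∀ b, s b ∈ C) ∧ ∀ a b, s b ∈ N (r a) ↔ (a = b → a = 2) := by
  classical
  obtain ⟨i₀, hi₀, h3⟩ : ∃ i ∈ B, 3 ≤ (N i).card := by
    by_contra! h
    have h1 := Finset.sum_le_sum fun i hi => Nat.le_of_lt_succ (h i hi)
    rw [Finset.sum_const, hsum, hB] at h1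
    simp at h1
  have hN₀ : N i₀ = C := Finset.eq_of_subset_of_card_le (hN i₀ hi₀) (hC ▸ h3)
  obtain ⟨i₁, i₂, h12, hBe⟩ := Finset.card_eq_two.1
    (show (B.erase i₀).card = 2 by rw [Finset.card_erase_of_mem hi₀, hB])
  have hi₁ : i₁ ≠ i₀ ∧ i₁ ∈ B := Finset.mem_erase.1 (hBe ▸ by simp)
  have hi₂ : i₂ ≠ i₀ ∧ i₂ ∈ B := Finset.mem_erase.1 (hBe ▸ by simp)
  rw [← Finset.add_sum_erase _ _ hi₀, hBe, Finset.sum_pair h12, hN₀, hC] at hsum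
  have hd₁ := hdeg i₁
  have hd₂ := hdeg i₂
  obtain ⟨j₁, hj₁⟩ := Finset.card_eq_one.1 (show (C \ N i₁).card = 1 by
    rw [Finset.card_sdiff_of_subset (hN i₁ hi₁.2)]
    omega)
  obtain ⟨j₂, hj₂⟩ := Finset.card_eq_one.1 (show (C \ N i₂).card = 1 by
    rw [Finset.card_sdiff_of_subset (hN i₂ hi₂.2)]
    omega)
  have hmem₁ : ∀ j ∈ C, j ∈ N i₁ ↔ j ≠ j₁ := by
    intro j hj
    have h := Finset.ext_iff.1 hj₁ j
    simp only [Finset.mem_sdiff, hj, true_and, Finset.mem_singleton] at h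
    rw [← not_iff_not, h, not_not]
  have hmem₂ : ∀ j ∈ C, j ∈ N i₂ ↔ j ≠ j₂ := by
    intro j hj
    have h := Finset.ext_iff.1 hj₂ j
    simp only [Finset.mem_sdiff, hj, true_and, Finset.mem_singleton] at h
    rw [← not_iff_not, h, not_not]
  have hC₁ : j₁ ∈ C := (Finset.mem_sdiff.1 (hj₁ ▸ Finset.mem_singleton_self j₁)).1
  have hC₂ : j₂ ∈ C := (Finset.mem_sdiff.1 (hj₂ ▸ Finset.mem_singleton_self j₂)).1
  have hj12 : j₁ ≠ j₂ := by
    rintro rfl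
    obtain ⟨i, hi, hne, hj⟩ := hcol i₀ j₁ hC₁
    have h : i ∈ B.erase i₀ := Finset.mem_erase.2 ⟨hne, hi⟩
    rw [hBe, Finset.mem_insert, Finset.mem_singleton] at h
    rcases h with rfl | rfl
    · exact (hmem₁ j₁ hC₁).1 hj rfl
    · exact (hmem₂ j₁ hC₁).1 hj rfl
  obtain ⟨j₀, hj₀⟩ := Finset.card_eq_one.1 (show (C \ {j₁, j₂}).card = 1 by
    rw [Finset.card_sdiff_of_subset (by simp [Finset.insert_subset_iff, hC₁, hC₂]),
      Finset.card_pair hj12, hC])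
  have hC₀ : j₀ ∈ C ∧ j₀ ≠ j₁ ∧ j₀ ≠ j₂ := by
    have h : j₀ ∈ C \ {j₁, j₂} := hj₀ ▸ Finset.mem_singleton_self j₀
    simpa using h
  refine ⟨![i₁, i₂, i₀], ![j₁, j₂, j₀], ?_, ?_, ?_, ?_, ?_⟩
  · intro a b
    fin_cases a <;> fin_cases b <;> simp [h12, h12.symm, hi₁.1, hi₂.1, hi₁.1.symm, hi₂.1.symm]
  · intro a b
    fin_cases a <;> fin_cases b <;>
      simp [hj12, hj12.symm, hC₀.2.1, hC₀.2.2, hC₀.2.1.symm, hC₀.2.2.symm]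
  · intro a
    fin_cases a <;> simp [hi₀, hi₁.2, hi₂.2]
  · intro a
    fin_cases a <;> simp [hC₀.1, hC₁, hC₂]
  · intro a b
    fin_cases a <;> fin_cases b <;>
      simp [hmem₁, hmem₂, hN₀, hC₀, hC₁, hC₂, hj12, hj12.symm]

/-- Irreducible support polytopes of dimension `d` on `2 * d - 1` rows have the face poset of the
product of a cube and a triangle. -/
lemma nonempty_facesOf_orderIso_of_irreducible {I J : Type*} [Fintype I] [Fintype J]
    {N : I → Finset J} {M : Matrix I J ℝ} {d : ℕ}
    (hM : M ∈ supportPolytope N) (hpos : ∀ i, ∀ j ∈ N i, 0 < M i j)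
    (hcard : Fintype.card I = Fintype.card J) (hdeg : ∀ i, 2 ≤ (N i).card)
    (hirr : ∀ v w₁ w₂, w₁ ≠ w₂ → {w₁, w₂} = (N v : Set J) → ∃ u ≠ v, w₁ ∈ N u ∧ w₂ ∈ N u)
    (hdim : Module.finrank ℝ (vectorSpan ℝ (supportPolytope N)) = d)
    (hI : Fintype.card I + 1 = 2 * d) :
    Nonempty (facesOf (supportPolytope N) ≃o
      facesOf (Set.Icc (0 : Fin (d - 2) → ℝ) 1 ×ˢ stdSimplex ℝ (Fin 3))) := by
  classical
  obtain ⟨κ, _, _, f, g, k₀, hfg, hfib, h2, h3, h7⟩ :=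
    exists_component_structure hM hpos hcard hdeg hirr (by rw [hdim, hI])
  have hNg : ∀ k, ∀ i ∈ Finset.univ.filter (fun i => f i = k),
      N i ⊆ Finset.univ.filter fun j => g j = k := by
    intro k i hi j hj
    simp only [Finset.mem_filter, Finset.mem_univ, true_and] at hi ⊢
    rw [← hfg i j hj, hi]
  have hfull : ∀ k ≠ k₀, ∀ i j, f i = k → g j = k → j ∈ N i := by
    intro k hk i j hi hj
    rw [Finset.eq_of_subset_of_card_le (hNg k i (by simpa using hi))]
    · simpa using hj
    · rw [← hfib, h2 k hk]
      exact hdeg i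
  obtain ⟨r, s, hr, hs, hrB, hsC, hrs⟩ := exists_triangle_labelling h3 (hfib k₀ ▸ h3) (hNg k₀)
    hdeg h7 (by
      intro i j hj
      obtain ⟨i', hi', hj'⟩ := exists_ne_mem hM hpos hcard hdeg i j
      refine ⟨i', ?_, hi', hj'⟩
      simp only [Finset.mem_filter, Finset.mem_univ, true_and] at hj ⊢
      rw [hfg i' j hj', hj])
  simp only [Finset.mem_filter, Finset.mem_univ, true_and] at hrB hsC
  have hsum : Fintype.card I = 3 + ∑ k ∈ Finset.univ.erase k₀, 2 := by
    rw [← h3, ← Finset.sum_congr rfl fun k hk => h2 k (Finset.ne_of_mem_erase hk),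
      Finset.add_sum_erase _ (fun k => (Finset.univ.filter fun i => f i = k).card)
        (Finset.mem_univ k₀)]
    exact Finset.card_eq_sum_card_fiberwise fun _ _ => Finset.mem_coe.2 (Finset.mem_univ _)
  have hκ : Fintype.card {k // k ≠ k₀} = d - 2 := by
    have h : Fintype.card {k // k ≠ k₀} = (Finset.univ.erase k₀).card :=
      Fintype.card_of_subtype _ (by simp)
    rw [Finset.sum_const, smul_eq_mul, ← h] at hsum
    omega
  let e := (Fintype.equivFinOfCardEq hκ).symm
  let p : ∀ k, Fin 2 ≃ {i // f i = e k} := fun k =>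
    (Fintype.equivFinOfCardEq ((Fintype.card_subtype _).trans (h2 _ (e k).2))).symm
  let q : ∀ k, Fin 2 ≃ {j // g j = e k} := fun k =>
    (Fintype.equivFinOfCardEq
      ((Fintype.card_subtype _).trans ((hfib _).symm.trans (h2 _ (e k).2)))).symm
  let φ : (Fin (d - 2) × Fin 2) ⊕ Fin 3 → I := Sum.elim (fun x => p x.1 x.2) r
  let ψ : (Fin (d - 2) × Fin 2) ⊕ Fin 3 → J := Sum.elim (fun x => q x.1 x.2) s
  have hφ : Function.Injective φ := by
    refine Function.Injective.sumElim ?_ hr fun x a h => (e x.1).2 ?_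
    · rintro ⟨k, a⟩ ⟨k', a'⟩ h
      have h1 := (p k a).2
      rw [show (p k a : I) = p k' a' from h, (p k' a').2] at h1
      obtain rfl : k' = k := e.injective (Subtype.ext h1)
      exact congrArg (Prod.mk k') ((p k').injective (Subtype.ext h))
    · exact (p x.1 x.2).2.symm.trans ((congrArg f h).trans (hrB a))
  have hψ : Function.Injective ψ := by
    refine Function.Injective.sumElim ?_ hs fun x a h => (e x.1).2 ?_
    · rintro ⟨k, a⟩ ⟨k', a'⟩ h
      have h1 := (q k a).2
      rw [show (q k a : J) = q k' a' from h, (q k' a').2] at h1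
      obtain rfl : k' = k := e.injective (Subtype.ext h1)
      exact congrArg (Prod.mk k') ((q k').injective (Subtype.ext h))
    · exact (q x.1 x.2).2.symm.trans ((congrArg g h).trans (hsC a))
  have hcardφ : Fintype.card ((Fin (d - 2) × Fin 2) ⊕ Fin 3) = Fintype.card I := by
    rw [Finset.sum_const, smul_eq_mul] at hsum
    simp only [Fintype.card_sum, Fintype.card_prod, Fintype.card_fin]
    omega
  have hφb := (Fintype.bijective_iff_injective_and_card φ).2 ⟨hφ, hcardφ⟩
  have hψb := (Fintype.bijective_iff_injective_and_card ψ).2 ⟨hψ, hcardφ.trans hcard⟩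
  have hrel : ∀ i j, j ∈ cubeTriangleSupport (Fin (d - 2)) i ↔ ψ j ∈ N (φ i) := by
    intro i j
    rw [mem_cubeTriangleSupport]
    rcases i with ⟨k, a⟩ | a <;> rcases j with ⟨k', b⟩ | b
    · constructor
      · rintro (rfl : k = k')
        exact hfull _ (e k).2 _ _ (p k a).2 (q k b).2
      · intro h
        have h1 := hfg _ _ h
        exact e.injective (Subtype.ext ((p k a).2.symm.trans (h1.trans (q k' b).2)))
    · exact ⟨False.elim, fun h => (e k).2 ((p k a).2.symm.trans ((hfg _ _ h).trans (hsC b)))⟩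
    · exact ⟨False.elim, fun h => (e k').2 ((q k' b).2.symm.trans ((hfg _ _ h).symm.trans (hrB a)))⟩
    · exact (hrs a b).symm
  obtain ⟨α⟩ := nonempty_facesOf_orderIso_reindex N (cubeTriangleSupport (Fin (d - 2)))
    (Equiv.ofBijective φ hφb) (Equiv.ofBijective ψ hψb) hrel
  obtain ⟨β⟩ := nonempty_facesOf_orderIso_cube_prod_triangle (κ := Fin (d - 2))
  exact ⟨α.trans β⟩

end CubeTriangle

/-- A `d`-dimensional combinatorial type of Birkhoff face with Birkhoff dimension
`2d - 1` is a product of a `(d-2)`-cube and a triangle. -/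
theorem stmt16 (d : ℕ) (hd : 2 ≤ d)
    (F : Set (Matrix (Fin (2 * d - 1)) (Fin (2 * d - 1)) ℝ))
    (hne : F.Nonempty) (hconv : Convex ℝ F)
    (hext : IsExtreme ℝ
      (doublyStochastic ℝ (Fin (2 * d - 1)) :
        Set (Matrix (Fin (2 * d - 1)) (Fin (2 * d - 1)) ℝ)) F)
    (hdim : Module.finrank ℝ ↥(vectorSpan ℝ F) = d)
    (hmin : ∀ m < 2 * d - 1, ∀ F' : Set (Matrix (Fin m) (Fin m) ℝ),
      Convex ℝ F' →
      IsExtreme ℝ (doublyStochastic ℝ (Fin m) : Set (Matrix (Fin m) (Fin m) ℝ)) F' →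
      ¬ Nonempty (↥(facesOf F) ≃o ↥(facesOf F'))) :
    Nonempty (↥(facesOf F) ≃o
      ↥(facesOf ((Set.Icc (0 : Fin (d - 2) → ℝ) 1) ×ˢ (stdSimplex ℝ (Fin 3))))) := by
  classical
  have : Nonempty (Fin (2 * d - 1)) := ⟨⟨0, by omega⟩⟩
  obtain ⟨N, rfl, M, hM, hpos⟩ := exists_eq_supportPolytope hne hconv hext
  have hmin' : ∀ (i j : Fin (2 * d - 1)) (N' : {i' // i' ≠ i} → Finset {j' // j' ≠ j}),
      ¬ Nonempty (facesOf (supportPolytope N) ≃o facesOf (supportPolytope N')) := by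
    rintro i j N' ⟨α⟩
    obtain ⟨F', hc, he, ⟨β⟩⟩ := exists_face_doublyStochastic (m := 2 * d - 1 - 1)
      (by simp [Fintype.card_subtype_compl]) (by simp [Fintype.card_subtype_compl]) N'
    exact hmin _ (by omega) F' hc he ⟨α.trans β⟩
  refine nonempty_facesOf_orderIso_of_irreducible hM hpos rfl (fun i => ?_) ?_ hdim
    (by rw [Fintype.card_fin]; omega)
  · by_contra hlt
    obtain ⟨j, hj⟩ : (N i).Nonempty := by
      rw [Finset.nonempty_iff_ne_empty]
      intro h
      have h1 := hM.2.2.1 i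
      rw [Finset.sum_eq_zero fun j _ => hM.2.1 i j (by simp [h])] at h1
      exact zero_ne_one h1
    have h1 := Finset.eq_of_subset_of_card_le (Finset.singleton_subset_iff.2 hj)
      (by rw [Finset.card_singleton]; omega)
    exact hmin' _ _ _ (nonempty_facesOf_orderIso_delete N h1.symm)
  · intro v w₁ w₂ hw hv
    by_contra! h
    have hv' : N v = {w₁, w₂} := Finset.coe_injective (by simp [← hv])
    exact hmin' _ _ _ (nonempty_facesOf_orderIso_contract N hw hv' fun u hu hmem =>
      h u hu hmem.1 hmem.2)
end
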